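/- arXiv:1811.06852 — 2 statements merged into one kernel-verified Lean document; each statement's English description precedes it below -/
import Mathlib

section
/- Let K>2, let μ be a probability measure on a set B ⊂ B_{ℝ^n}(0,K), and let S be a compact subset of ℝ^n (or of ℝ^m). Assume that for every b∈B there is a measurable set S_b ⊂ S with |S_b| ≥ K^{−1}|S|, where |·| is Lebesgue measure. Then there exist b_o ∈ B and B₁ ⊂ B ∩ B(b_o, 1/K²) containing b_o such that μ(B₁) ≥ K^{−O(1)} and for every b ∈ B₁, |S_b ∩ S_{b_o}| ≥ K^{−O(1)} |S|, where the implied constants depend only on the dimension. -/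
open MeasureTheory Metric Set
open scoped Real ENNReal

noncomputable section

/-- `ℝ^n` with the Euclidean structure. -/
abbrev En (n : ℕ) : Type := EuclideanSpace ℝ (Fin n)

/-- Bonferroni-type lower bound for the measure of a finite union. -/
theorem card_mul_sub_sq_le_measureReal_biUnion {α ι : Type*} [MeasurableSpace α]
    (ν : Measure α) (A : ι → Set α) {a d : ℝ} (hd : 0 ≤ d) (T : Finset ι)
    (hA : ∀ i ∈ T, MeasurableSet (A i) ∧ ν (A i) ≠ ∞ ∧ a ≤ ν.real (A i))
    (hT : (T : Set ι).Pairwise fun i j => ν.real (A i ∩ A j) ≤ d) :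
    T.card * a - (T.card : ℝ) ^ 2 * d ≤ ν.real (⋃ i ∈ T, A i) := by
  classical
  induction T using Finset.induction_on with
  | empty => simp
  | insert i T hi ih =>
    have ih' := ih (fun j hj => hA j (Finset.mem_insert_of_mem hj))
      (hT.mono (by simp))
    obtain ⟨hm, hfin, ha⟩ := hA i (Finset.mem_insert_self i T)
    have hfinU : ν (⋃ j ∈ T, A j) ≠ ∞ :=
      (measure_biUnion_lt_top T.finite_toSet
        fun j hj => (hA j (Finset.mem_insert_of_mem hj)).2.1.lt_top).ne
    have hinter : ν.real (A i ∩ ⋃ j ∈ T, A j) ≤ T.card * d := by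
      rw [inter_iUnion₂]
      refine (measureReal_biUnion_finset_le T _).trans ?_
      rw [← nsmul_eq_mul]
      refine Finset.sum_le_card_nsmul T _ d fun j hj => ?_
      exact hT (by simp) (by simp [hj]) (by rintro rfl; exact hi hj)
    have hUm : MeasurableSet (⋃ j ∈ T, A j) :=
      T.measurableSet_biUnion fun j hj => (hA j (Finset.mem_insert_of_mem hj)).1
    have hadd := measureReal_union_add_inter (μ := ν) (s := A i) hUm hfin hfinU
    rw [Finset.set_biUnion_insert, Finset.card_insert_of_notMem hi]
    push_cast
    nlinarith [mul_nonneg (Nat.cast_nonneg (α := ℝ) T.card) hd]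

/-- Sets of density at least `θ` with pairwise intersections of density at most `θ² / 8`
number at most `3 / θ`. -/
theorem card_le_of_pairwise_measureReal_inter_le {α ι : Type*} [MeasurableSpace α]
    (ν : Measure α) (A : ι → Set α) {U : Set α} {θ : ℝ} (hθ : 0 < θ) (hθ1 : θ ≤ 1)
    (hU : ν U ≠ ∞) (hU0 : 0 < ν.real U) (T : Finset ι)
    (hA : ∀ i ∈ T, MeasurableSet (A i) ∧ A i ⊆ U ∧ θ * ν.real U ≤ ν.real (A i))
    (hT : (T : Set ι).Pairwise fun i j => ν.real (A i ∩ A j) ≤ θ ^ 2 / 8 * ν.real U) :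
    (T.card : ℝ) ≤ 3 / θ := by
  have hceil : (⌈2 / θ⌉₊ : ℝ) < 2 / θ + 1 := Nat.ceil_lt_add_one (by positivity)
  have hone : 1 ≤ 1 / θ := by rwa [le_div_iff₀ hθ, one_mul]
  have hthree : (⌈2 / θ⌉₊ : ℝ) ≤ 3 / θ := by
    have : 3 / θ = 2 / θ + 1 / θ := by ring
    linarith
  by_contra! hcard
  obtain ⟨T', hT', hcard'⟩ := Finset.exists_subset_card_eq
    (s := T) (n := ⌈2 / θ⌉₊) (by exact_mod_cast hthree.trans hcard.le)
  have hlower := card_mul_sub_sq_le_measureReal_biUnion ν A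
    (a := θ * ν.real U) (d := θ ^ 2 / 8 * ν.real U) (by positivity) T'
    (fun i hi => ⟨(hA i (hT' hi)).1, measure_ne_top_of_subset (hA i (hT' hi)).2.1 hU,
      (hA i (hT' hi)).2.2⟩)
    (hT.mono (by exact_mod_cast hT'))
  have hupper : ν.real (⋃ i ∈ T', A i) ≤ ν.real U :=
    measureReal_mono (iUnion₂_subset fun i hi => (hA i (hT' hi)).2.1) hU
  rw [hcard'] at hlower
  have hx2 : 2 ≤ ⌈2 / θ⌉₊ * θ := by
    rw [← div_le_iff₀ hθ]; exact Nat.le_ceil _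
  have hx3 : ⌈2 / θ⌉₊ * θ ≤ 3 := by
    rwa [← le_div_iff₀ hθ]
  set x : ℝ := ⌈2 / θ⌉₊ * θ with hx
  have hle : (x - x ^ 2 / 8) * ν.real U ≤ 1 * ν.real U := by
    rw [hx]; linarith
  have := le_of_mul_le_mul_right hle hU0
  nlinarith

/-- If the finite subsets of `B` that are independent for a reflexive symmetric relation `R`
have bounded size, then some `R`-neighbourhood has proportionally large outer measure. -/
theorem exists_le_measure_related {α : Type*} [MeasurableSpace α] (μ : Measure α) {B : Set α}
    (hB : μ B ≠ 0) (R : α → α → Prop) (hrefl : ∀ b ∈ B, R b b)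
    (hsymm : ∀ b c, R b c → R c b) {M : ℕ} {c : ℝ≥0∞}
    (hM : ∀ T : Finset α, (T : Set α) ⊆ B → (T : Set α).Pairwise (fun b b' => ¬ R b b') →
      T.card ≤ M) (hc : M * c ≤ μ B) :
    ∃ bo ∈ B, c ≤ μ {b ∈ B | R b bo} := by
  classical
  let P : ℕ → Prop := fun k => ∃ T : Finset α, (T : Set α) ⊆ B ∧
    (T : Set α).Pairwise (fun b b' => ¬ R b b') ∧ T.card = k
  obtain ⟨T, hTB, hTR, hTcard⟩ : P (Nat.findGreatest P M) :=
    Nat.findGreatest_spec (P := P) (Nat.zero_le M) ⟨∅, by simp⟩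
  have hcover : B ⊆ ⋃ t ∈ T, {b ∈ B | R b t} := by
    intro b hb
    by_contra hnot
    simp only [mem_iUnion, mem_ofPred_eq, exists_prop, not_exists, not_and] at hnot
    have hbT : b ∉ T := fun h => hnot b h hb (hrefl b hb)
    have hins : P (T.card + 1) := by
      refine ⟨insert b T, ?_, ?_, Finset.card_insert_of_notMem hbT⟩
      · rw [Finset.coe_insert]
        exact insert_subset hb hTB
      · rw [Finset.coe_insert]
        exact hTR.insert fun t ht _ => ⟨hnot t ht hb, fun h => hnot t ht hb (hsymm _ _ h)⟩
    obtain ⟨T', h1, h2, h3⟩ := id hins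
    have := Nat.le_findGreatest (h3 ▸ hM T' h1 h2) hins
    omega
  have hTne : T.Nonempty := by
    rw [Finset.nonempty_iff_ne_empty]
    rintro rfl
    exact hB (measure_mono_null hcover (by simp))
  have hsum : ∑ _t ∈ T, c ≤ ∑ t ∈ T, μ {b ∈ B | R b t} := by
    rw [Finset.sum_const, nsmul_eq_mul]
    calc (T.card : ℝ≥0∞) * c ≤ M * c := by gcongr; exact hM T hTB hTR
      _ ≤ μ B := hc
      _ ≤ _ := (measure_mono hcover).trans (measure_biUnion_finset_le T _)
  by_contra! hlt
  exact (ENNReal.sum_lt_sum_of_nonempty hTne fun t ht => hlt t (hTB ht)).not_ge hsum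

theorem common_large_intersection_of_pos {n : ℕ} {K : ℝ} (hK : 2 < K) {B : Set (En n)}
    {μ : Measure (En n)} (hμB : μ B = 1) (hBK : B ⊆ closedBall (0 : En n) K)
    {S : Set (En n)} (hS : IsCompact S) (hS0 : volume S ≠ 0) {Sb : En n → Set (En n)}
    (hSb : ∀ b ∈ B, Sb b ⊆ S ∧ MeasurableSet (Sb b) ∧
      ENNReal.ofReal K⁻¹ * volume S ≤ volume (Sb b)) :
    ∃ bo ∈ B, ENNReal.ofReal (K ^ (5 * n + 5))⁻¹ ≤
      μ {b ∈ B | dist b bo ≤ 1 / K ^ 2 ∧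
        ENNReal.ofReal (K ^ (5 * n + 5))⁻¹ * volume S ≤ volume (Sb b ∩ Sb bo)} := by
  have hK0 : 0 < K := by linarith
  set δ : ℝ := (K ^ (5 * n + 5))⁻¹ with hδ
  have hδ0 : 0 < δ := by positivity
  have hSfin : volume S ≠ ∞ := hS.measure_lt_top.ne
  set v : ℝ := volume.real S with hv
  have hv0 : 0 < v := ENNReal.toReal_pos hS0 hSfin
  have hSv : volume S = ENNReal.ofReal v := (ENNReal.ofReal_toReal hSfin).symm
  set β : ℝ := volume.real (ball (0 : En n) 1) with hβ
  have hβ0 : 0 < β :=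
    ENNReal.toReal_pos (measure_ball_pos volume _ one_pos).ne' measure_ball_lt_top.ne
  set p : ℝ := (1 / (2 * K ^ 2)) ^ n with hp
  set q : ℝ := (K + 1) ^ n with hq
  have hp0 : 0 < p := by positivity
  have hq0 : 0 < q := by positivity
  have hballp (b : En n) : volume.real (ball b (1 / (2 * K ^ 2))) = p * β := by
    rw [measureReal_def, Measure.addHaar_ball_of_pos _ _ (by positivity),
      ENNReal.toReal_mul, ENNReal.toReal_ofReal (by positivity), finrank_euclideanSpace_fin]
    rfl
  have hballq : volume.real (ball (0 : En n) (K + 1)) = q * β := by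
    rw [measureReal_def, Measure.addHaar_ball_of_pos _ _ (by positivity),
      ENNReal.toReal_mul, ENNReal.toReal_ofReal (by positivity), finrank_euclideanSpace_fin]
    rfl
  have hK8 : 8 ≤ K ^ 3 := by
    calc (8 : ℝ) = 2 ^ 3 := by norm_num
      _ ≤ K ^ 3 := by gcongr
  have hqp : q ≤ K ^ (5 * n) * p := by
    rw [hp, hq, pow_mul, ← mul_pow]
    gcongr
    have : K ^ 5 * (1 / (2 * K ^ 2)) = K ^ 3 / 2 := by field_simp
    rw [this]
    nlinarith [mul_pos hK0 hK0, mul_nonneg hK0.le (mul_self_nonneg (K - 2))]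
  have hpq : p ≤ q := by
    rw [hp, hq]
    gcongr
    rw [div_le_iff₀ (by positivity)]
    nlinarith [sq_nonneg K]
  set θ : ℝ := p / (q * K) with hθ
  have hθ0 : 0 < θ := by positivity
  have hθ1 : θ ≤ 1 := by
    rw [hθ, div_le_one (by positivity)]
    nlinarith
  have hδθ : δ * (p / q) ≤ θ ^ 2 / 8 := by
    have h : δ * (8 * q * K ^ 2) ≤ p := by
      rw [hδ, inv_mul_le_iff₀ (by positivity)]
      calc 8 * q * K ^ 2 ≤ K ^ 3 * (K ^ (5 * n) * p) * K ^ 2 := by gcongr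
        _ = _ := by ring
    have : θ ^ 2 / 8 = p * (p / q) / (8 * q * K ^ 2) := by rw [hθ]; field_simp
    rw [this, le_div_iff₀ (by positivity)]
    calc δ * (p / q) * (8 * q * K ^ 2) = δ * (8 * q * K ^ 2) * (p / q) := by ring
      _ ≤ p * (p / q) := by gcongr
  have hM : 3 / θ ≤ K ^ (5 * n + 5) := by
    rw [hθ, div_div_eq_mul_div, div_le_iff₀ hp0]
    calc 3 * (q * K) ≤ K ^ 3 * (K ^ (5 * n) * p * K ^ 2) := by
          gcongr
          · linarith
          · nlinarith
      _ = _ := by ring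
  refine exists_le_measure_related μ (by simp [hμB])
    (fun b b' => dist b b' ≤ 1 / K ^ 2 ∧ ENNReal.ofReal δ * volume S ≤ volume (Sb b ∩ Sb b'))
    (fun b hb => ⟨by rw [dist_self]; positivity, ?_⟩)
    (fun b c h => by rwa [dist_comm, inter_comm]) (M := ⌊3 / θ⌋₊) ?_ ?_
  · rw [inter_self]
    refine le_trans ?_ (hSb b hb).2.2
    rw [hδ]
    gcongr
    exact le_self_pow₀ (by linarith) (by omega)
  · intro T hTB hT
    apply Nat.le_floor
    have hU : (volume.prod volume).real (ball (0 : En n) (K + 1) ×ˢ S) = q * β * v := by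
      rw [measureReal_prod_prod, hballq]
    refine card_le_of_pairwise_measureReal_inter_le (volume.prod volume)
      (fun b => ball b (1 / (2 * K ^ 2)) ×ˢ Sb b) (U := ball (0 : En n) (K + 1) ×ˢ S)
      hθ0 hθ1 ?_ (by rw [hU]; positivity) T (fun b hb => ⟨?_, ?_, ?_⟩) ?_
    · rw [Measure.prod_prod]
      exact ENNReal.mul_ne_top measure_ball_lt_top.ne hSfin
    · exact measurableSet_ball.prod (hSb b (hTB hb)).2.1
    · refine prod_mono (ball_subset_ball' ?_) (hSb b (hTB hb)).1
      have h1 : dist b 0 ≤ K := hBK (hTB hb)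
      have h2 : 1 / (2 * K ^ 2) ≤ 1 := by
        rw [div_le_one (by positivity)]; nlinarith
      linarith
    · have hb' := hSb b (hTB hb)
      rw [hU, measureReal_prod_prod, hballp]
      have hlow : K⁻¹ * v ≤ volume.real (Sb b) := by
        refine (ENNReal.ofReal_le_iff_le_toReal (measure_ne_top_of_subset hb'.1 hSfin)).1 ?_
        rw [ENNReal.ofReal_mul (by positivity), ← hSv]
        exact hb'.2.2
      calc θ * (q * β * v) = p * β * (K⁻¹ * v) := by rw [hθ]; field_simp
        _ ≤ _ := by gcongr
    · intro b hb b' hb' hne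
      have hnot := hT hb hb' hne
      rw [hU, prod_inter_prod, measureReal_prod_prod]
      by_cases hdist : dist b b' ≤ 1 / K ^ 2
      · have hlt : volume (Sb b ∩ Sb b') ≤ ENNReal.ofReal (δ * v) := by
          rw [ENNReal.ofReal_mul hδ0.le, ← hSv]
          exact (not_le.1 fun h => hnot ⟨hdist, h⟩).le
        have hreal : volume.real (Sb b ∩ Sb b') ≤ δ * v :=
          ENNReal.toReal_le_of_le_ofReal (by positivity) hlt
        have hball : volume.real (ball b (1 / (2 * K ^ 2)) ∩ ball b' (1 / (2 * K ^ 2)))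
            ≤ p * β := by
          rw [← hballp b]
          exact measureReal_mono inter_subset_left measure_ball_lt_top.ne
        calc _ ≤ p * β * (δ * v) := by gcongr
          _ = δ * (p / q) * (q * β * v) := by field_simp
          _ ≤ _ := by gcongr
      · have hdisj : Disjoint (ball b (1 / (2 * K ^ 2))) (ball b' (1 / (2 * K ^ 2))) := by
          apply ball_disjoint_ball
          have : 1 / (2 * K ^ 2) + 1 / (2 * K ^ 2) = 1 / K ^ 2 := by field_simp; norm_num
          rw [this]
          exact (not_le.1 hdist).le
        rw [hdisj.inter_eq, measureReal_empty, zero_mul]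
        positivity
  · rw [hμB, ← ENNReal.ofReal_natCast, ← ENNReal.ofReal_mul (by positivity),
      ENNReal.ofReal_le_one, hδ, ← div_eq_mul_inv, div_le_one (by positivity)]
    exact (Nat.floor_le (by positivity)).trans hM

/-- Pigeonholing a family of large subsets: there is a constant `C = O(1)` depending only
on the dimension such that for every `K > 2`, every probability measure `μ` on a set
`B ⊆ B(0,K)`, every compact `S ⊆ ℝ^n`, and every family of measurable sets `S_b ⊆ S`
(`b ∈ B`) with `|S_b| ≥ K⁻¹ |S|`, there exist `b_o ∈ B` and
`B₁ ⊆ B ∩ B(b_o, 1/K²)` containing `b_o` with `μ(B₁) ≥ K^{-C}` and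
`|S_b ∩ S_{b_o}| ≥ K^{-C} |S|` for every `b ∈ B₁`. -/
theorem common_large_intersection (n : ℕ) :
    ∃ C : ℝ, 0 < C ∧ ∀ K : ℝ, 2 < K →
      ∀ (B : Set (En n)) (μ : Measure (En n)), IsProbabilityMeasure μ → μ Bᶜ = 0 →
        B ⊆ closedBall (0 : En n) K →
        ∀ S : Set (En n), IsCompact S →
          ∀ Sb : En n → Set (En n),
            (∀ b ∈ B, Sb b ⊆ S ∧ MeasurableSet (Sb b) ∧
              ENNReal.ofReal K⁻¹ * volume S ≤ volume (Sb b)) →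
            ∃ bo ∈ B, ∃ B₁ ⊆ B ∩ closedBall bo (1 / K ^ 2), bo ∈ B₁ ∧
              ENNReal.ofReal (K ^ (-C)) ≤ μ B₁ ∧
              ∀ b ∈ B₁, ENNReal.ofReal (K ^ (-C)) * volume S ≤ volume (Sb b ∩ Sb bo) := by
  refine ⟨((5 * n + 5 : ℕ) : ℝ), by positivity, ?_⟩
  intro K hK B μ hμ hBc hBK S hS Sb hSb
  have hK0 : 0 < K := by linarith
  rw [Real.rpow_neg hK0.le, Real.rpow_natCast]
  have hμB : μ B = 1 := by
    rw [← measure_univ (μ := μ)]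
    exact measure_eq_measure_of_null_sdiff (subset_univ _) (by rwa [← compl_eq_univ_sdiff])
  have key : ∃ bo ∈ B, ENNReal.ofReal (K ^ (5 * n + 5))⁻¹ ≤
      μ {b ∈ B | dist b bo ≤ 1 / K ^ 2 ∧
        ENNReal.ofReal (K ^ (5 * n + 5))⁻¹ * volume S ≤ volume (Sb b ∩ Sb bo)} := by
    by_cases hS0 : volume S = 0
    · obtain ⟨bo, hbo, hle⟩ := common_large_intersection_of_pos hK hμB hBK
        (isCompact_closedBall (0 : En n) 1) (measure_closedBall_pos volume _ one_pos).ne'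
        (Sb := fun _ => closedBall 0 1) fun b _ => ⟨subset_rfl, measurableSet_closedBall,
          mul_le_of_le_one_left' (ENNReal.ofReal_le_one.2 (inv_le_one_of_one_le₀ (by linarith)))⟩
      refine ⟨bo, hbo, hle.trans (measure_mono fun b hb => ⟨hb.1, hb.2.1, ?_⟩)⟩
      simp [hS0]
    · exact common_large_intersection_of_pos hK hμB hBK hS hS0 hSb
  obtain ⟨bo, hbo, hle⟩ := key
  refine ⟨bo, hbo, {b ∈ B | dist b bo ≤ 1 / K ^ 2 ∧
    ENNReal.ofReal (K ^ (5 * n + 5))⁻¹ * volume S ≤ volume (Sb b ∩ Sb bo)},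
    fun b hb => ⟨hb.1, hb.2.1⟩, ⟨hbo, ?_, ?_⟩, hle, fun b hb => hb.2.2⟩
  · rw [dist_self]; positivity
  · rw [inter_self]
    refine le_trans ?_ (hSb bo hbo).2.2
    gcongr
    exact le_self_pow₀ (by linarith) (by omega)

end
end

section
/- Given κ>0 and σ∈(0,2), there exists ε>0 such that for all sufficiently small δ>0 the following holds. Let A, X ⊂ B_ℂ(0, δ^{−ε}) satisfy: (i) for all ρ≥δ, 𝒩_ρ(A) ≥ δ^ε ρ^{−κ}; (ii) A is δ^ε away from ℝ inside ℂ, i.e. there exists a∈A with |Im a| ≥ δ^ε; (iii) for all ρ≥δ, 𝒩_ρ(X) ≥ δ^ε ρ^{−κ}; (iv) 𝒩_δ(X) ≤ δ^{−(2−σ)−ε}. Then 𝒩_δ(X+X) + sup_{a∈A} 𝒩_δ(X + aX) ≥ δ^{−ε} 𝒩_δ(X), where aX = {a·x : x∈X} with complex multiplication. -/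
open MeasureTheory Metric Set
open scoped Real ENNReal Pointwise

noncomputable section

/-- `coverNum δ A` is the minimal number of closed balls of radius `δ` needed to cover `A`. -/
def coverNum {α : Type*} [PseudoMetricSpace α] (δ : ℝ) (A : Set α) : ℕ :=
  sInf {N : ℕ | ∃ s : Finset α, s.card = N ∧ A ⊆ ⋃ x ∈ s, closedBall x δ}

/-! ### Separated sets and covering numbers -/

/-- Distinct points of `P` are at distance at least `ρ`. -/
def Separated (ρ : ℝ) (P : Finset ℂ) : Prop :=
  ∀ x ∈ P, ∀ y ∈ P, x ≠ y → ρ ≤ ‖x - y‖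

/-- `S` contains a `ρ`-separated set with at least `M` points. -/
def PackGE (ρ : ℝ) (S : Set ℂ) (M : ℝ) : Prop :=
  ∃ P : Finset ℂ, (P : Set ℂ) ⊆ S ∧ Separated ρ P ∧ M ≤ P.card

theorem Separated.subset {ρ : ℝ} {P Q : Finset ℂ} (h : Separated ρ P) (hQ : Q ⊆ P) :
    Separated ρ Q :=
  fun x hx y hy hxy => h x (hQ hx) y (hQ hy) hxy

/-- A `ρ`-separated family has injective parametrization and separated image. -/
theorem separated_image {ι : Type*} [DecidableEq ι] {ρ : ℝ} (hρ : 0 < ρ) (I : Finset ι)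
    (f : ι → ℂ) (h : ∀ i ∈ I, ∀ j ∈ I, i ≠ j → ρ ≤ ‖f i - f j‖) :
    Separated ρ (I.image f) ∧ (I.image f).card = I.card := by
  refine ⟨?_, Finset.card_image_of_injOn ?_⟩
  · intro x hx y hy hxy
    obtain ⟨i, hi, rfl⟩ := Finset.mem_image.1 hx
    obtain ⟨j, hj, rfl⟩ := Finset.mem_image.1 hy
    exact h i hi j hj (fun e => hxy (by rw [e]))
  · intro i hi j hj hij
    by_contra hne
    have := h i hi j hj hne
    rw [hij, sub_self, norm_zero] at this
    linarith

theorem Separated.card_le {ρ : ℝ} (hρ : 0 < ρ) {P : Finset ℂ} (h : Separated ρ P) {c : ℂ}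
    {r : ℝ} (hr : 0 ≤ r) (hP : ∀ x ∈ P, ‖x - c‖ ≤ r) :
    (P.card : ℝ) ≤ (1 + 2 * r / ρ) ^ 2 := by
  have hd : (P : Set ℂ).PairwiseDisjoint (fun x => ball x (ρ / 2)) := by
    intro x hx y hy hxy
    apply ball_disjoint_ball
    rw [dist_eq_norm]
    linarith [h x hx y hy hxy]
  have hsub : (⋃ x ∈ P, ball x (ρ / 2)) ⊆ closedBall c (r + ρ / 2) := by
    intro z hz
    simp only [mem_iUnion, mem_ball, mem_closedBall, exists_prop] at hz ⊢
    obtain ⟨x, hx, hzx⟩ := hz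
    have := hP x hx
    rw [← dist_eq_norm] at this
    linarith [dist_triangle z x c]
  have hvol := measure_mono (μ := volume) hsub
  rw [measure_biUnion_finset hd (fun _ _ => measurableSet_ball)] at hvol
  simp only [Complex.volume_ball, Complex.volume_closedBall, Finset.sum_const, nsmul_eq_mul] at hvol
  have h1 : ((P.card : ℝ≥0∞) * (ENNReal.ofReal (ρ / 2) ^ 2 * NNReal.pi)).toReal
      ≤ (ENNReal.ofReal (r + ρ / 2) ^ 2 * NNReal.pi).toReal :=
    ENNReal.toReal_mono (ENNReal.mul_ne_top (ENNReal.pow_ne_top ENNReal.ofReal_ne_top)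
      ENNReal.coe_ne_top) hvol
  simp only [ENNReal.toReal_mul, ENNReal.toReal_pow, ENNReal.toReal_natCast,
    ENNReal.coe_toReal, NNReal.coe_real_pi] at h1
  rw [ENNReal.toReal_ofReal (by positivity), ENNReal.toReal_ofReal (by positivity)] at h1
  have h2 : (P.card : ℝ) * (ρ / 2) ^ 2 ≤ (r + ρ / 2) ^ 2 := by
    have := Real.pi_pos
    rw [← mul_assoc] at h1
    exact le_of_mul_le_mul_right h1 this
  have h3 : (1 + 2 * r / ρ) ^ 2 = (r + ρ / 2) ^ 2 / (ρ / 2) ^ 2 := by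
    field_simp
    ring
  rw [h3, le_div_iff₀ (by positivity)]
  exact h2

/-- A property of finite sets that is stable at the empty set and bounded in cardinality has a
member of maximal cardinality. -/
theorem exists_maximal_card {α : Type*} (p : Finset α → Prop) (h0 : p ∅) (N : ℕ)
    (hN : ∀ P, p P → P.card ≤ N) : ∃ P, p P ∧ ∀ Q, p Q → Q.card ≤ P.card := by
  classical
  let q : ℕ → Prop := fun n => ∃ P, p P ∧ P.card = n
  have hq : q (Nat.findGreatest q N) :=
    Nat.findGreatest_spec (m := 0) (Nat.zero_le _) ⟨∅, h0, rfl⟩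
  obtain ⟨P, hP, hc⟩ := hq
  refine ⟨P, hP, fun Q hQ => ?_⟩
  rw [hc]
  exact Nat.le_findGreatest (hN Q hQ) ⟨Q, hQ, rfl⟩

theorem exists_maximal_separated {ρ : ℝ} (hρ : 0 < ρ) {S : Set ℂ} {r : ℝ}
    (hS : ∀ x ∈ S, ‖x‖ ≤ r) :
    ∃ P : Finset ℂ, (P : Set ℂ) ⊆ S ∧ Separated ρ P ∧ ∀ x ∈ S, ∃ p ∈ P, ‖x - p‖ < ρ := by
  classical
  obtain ⟨P, ⟨hPS, hP⟩, hmax⟩ := exists_maximal_card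
    (fun P : Finset ℂ => (P : Set ℂ) ⊆ S ∧ Separated ρ P)
    ⟨by simp, fun x hx => by simp at hx⟩ ⌊(1 + 2 * |r| / ρ) ^ 2⌋₊ (fun P hP => by
      apply Nat.le_floor
      refine hP.2.card_le hρ (c := 0) (abs_nonneg r) (fun x hx => ?_)
      rw [sub_zero]
      exact (hS x (hP.1 hx)).trans (le_abs_self r))
  refine ⟨P, hPS, hP, fun x hx => ?_⟩
  by_contra hcon
  push Not at hcon
  have hxP : x ∉ P := fun h => by
    have := hcon x h
    simp at this
    linarith
  have := hmax (insert x P) ⟨by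
    rw [Finset.coe_insert]
    exact insert_subset hx hPS, by
    intro a ha b hb hab
    rcases Finset.mem_insert.1 ha with rfl | ha' <;> rcases Finset.mem_insert.1 hb with rfl | hb'
    · exact absurd rfl hab
    · exact hcon b hb'
    · rw [norm_sub_rev]
      exact hcon a ha'
    · exact hP a ha' b hb' hab⟩
  rw [Finset.card_insert_of_notMem hxP] at this
  omega

theorem coverNum_le_card {ρ : ℝ} {S : Set ℂ} (P : Finset ℂ)
    (h : ∀ x ∈ S, ∃ p ∈ P, ‖x - p‖ ≤ ρ) : coverNum ρ S ≤ P.card := by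
  apply Nat.sInf_le
  refine ⟨P, rfl, fun x hx => ?_⟩
  obtain ⟨p, hp, hxp⟩ := h x hx
  simp only [mem_iUnion, mem_closedBall, exists_prop]
  exact ⟨p, hp, by rwa [dist_eq_norm]⟩

theorem exists_cover {ρ : ℝ} (hρ : 0 < ρ) {S : Set ℂ} {r : ℝ} (hS : ∀ x ∈ S, ‖x‖ ≤ r) :
    ∃ P : Finset ℂ, P.card = coverNum ρ S ∧ ∀ x ∈ S, ∃ p ∈ P, ‖x - p‖ ≤ ρ := by
  obtain ⟨P, -, -, hP⟩ := exists_maximal_separated hρ hS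
  have hne : {N : ℕ | ∃ s : Finset ℂ, s.card = N ∧ S ⊆ ⋃ x ∈ s, closedBall x ρ}.Nonempty := by
    refine ⟨P.card, P, rfl, fun x hx => ?_⟩
    obtain ⟨p, hp, hxp⟩ := hP x hx
    simp only [mem_iUnion, mem_closedBall, exists_prop]
    exact ⟨p, hp, by rw [dist_eq_norm]; exact hxp.le⟩
  obtain ⟨s, hs, hcov⟩ := Nat.sInf_mem hne
  refine ⟨s, hs, fun x hx => ?_⟩
  have := hcov hx
  simp only [mem_iUnion, mem_closedBall, exists_prop] at this
  obtain ⟨p, hp, hxp⟩ := this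
  exact ⟨p, hp, by rwa [dist_eq_norm] at hxp⟩

theorem packGE_coverNum {ρ : ℝ} (hρ : 0 < ρ) {S : Set ℂ} {r : ℝ} (hS : ∀ x ∈ S, ‖x‖ ≤ r) :
    PackGE ρ S (coverNum ρ S) := by
  obtain ⟨P, hPS, hP, hc⟩ := exists_maximal_separated hρ hS
  refine ⟨P, hPS, hP, ?_⟩
  exact_mod_cast coverNum_le_card P (fun x hx => (hc x hx).imp fun p hp => ⟨hp.1, hp.2.le⟩)

theorem coverNum_le_of_norm_le {ρ : ℝ} (hρ : 0 < ρ) {S : Set ℂ} {r : ℝ} (hr : 0 ≤ r)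
    (hS : ∀ x ∈ S, ‖x‖ ≤ r) : (coverNum ρ S : ℝ) ≤ (1 + 2 * r / ρ) ^ 2 := by
  obtain ⟨P, hPS, hP, hc⟩ := packGE_coverNum hρ hS
  refine hc.trans (hP.card_le hρ (c := 0) hr fun x hx => ?_)
  rw [sub_zero]
  exact hS x (hPS hx)

/-- A separated set each of whose points is near one of finitely many centres. -/
theorem Separated.card_le_mul {ρ : ℝ} (hρ : 0 < ρ) {P : Finset ℂ} (h : Separated ρ P)
    {r : ℝ} (hr : 0 ≤ r) (F : Finset ℂ) (hF : ∀ x ∈ P, ∃ f ∈ F, ‖x - f‖ ≤ r) :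
    (P.card : ℝ) ≤ F.card * (1 + 2 * r / ρ) ^ 2 := by
  classical
  have hsub : P ⊆ F.biUnion fun f => P.filter fun x => ‖x - f‖ ≤ r := by
    intro x hx
    obtain ⟨f, hf, hxf⟩ := hF x hx
    exact Finset.mem_biUnion.2 ⟨f, hf, Finset.mem_filter.2 ⟨hx, hxf⟩⟩
  calc (P.card : ℝ) ≤ ((F.biUnion fun f => P.filter fun x => ‖x - f‖ ≤ r).card : ℝ) := by
        exact_mod_cast Finset.card_le_card hsub
    _ ≤ ∑ f ∈ F, ((P.filter fun x => ‖x - f‖ ≤ r).card : ℝ) := by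
        exact_mod_cast Finset.card_biUnion_le
    _ ≤ ∑ _f ∈ F, (1 + 2 * r / ρ) ^ 2 := by
        refine Finset.sum_le_sum fun f _ => ?_
        exact (h.subset (Finset.filter_subset _ _)).card_le hρ hr
          fun x hx => (Finset.mem_filter.1 hx).2
    _ = F.card * (1 + 2 * r / ρ) ^ 2 := by rw [Finset.sum_const, nsmul_eq_mul]

theorem Separated.card_le_coverNum {ρ δ : ℝ} (hρ : 0 < ρ) (hδ : 0 < δ) {P : Finset ℂ}
    (h : Separated ρ P) {S : Set ℂ} {r u : ℝ} (hu : 0 ≤ u) (hS : ∀ x ∈ S, ‖x‖ ≤ r)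
    (hP : ∀ x ∈ P, ∃ y ∈ S, ‖x - y‖ ≤ u) :
    (P.card : ℝ) ≤ coverNum δ S * (1 + 2 * (u + δ) / ρ) ^ 2 := by
  obtain ⟨F, hF, hc⟩ := exists_cover hδ hS
  rw [← hF]
  refine h.card_le_mul hρ (by positivity) F fun x hx => ?_
  obtain ⟨y, hy, hxy⟩ := hP x hx
  obtain ⟨f, hf, hyf⟩ := hc y hy
  refine ⟨f, hf, ?_⟩
  calc ‖x - f‖ = ‖(x - y) + (y - f)‖ := by ring_nf
    _ ≤ u + δ := (norm_add_le _ _).trans (add_le_add hxy hyf)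

/-! ### An energy estimate -/

theorem card_sq_le_mul_energy {ι : Type*} [DecidableEq ι] {ρ U : ℝ} (hρ : 0 < ρ)
    (I : Finset ι) (f : ι → ℂ)
    (hU : ∀ P : Finset ℂ, P ⊆ I.image f → Separated ρ P → (P.card : ℝ) ≤ U) :
    (I.card : ℝ) ^ 2 ≤ U * ((I ×ˢ I).filter fun p => ‖f p.1 - f p.2‖ < 2 * ρ).card := by
  classical
  obtain ⟨r, hr⟩ : ∃ r : ℝ, ∀ x ∈ ((I.image f : Finset ℂ) : Set ℂ), ‖x‖ ≤ r := by
    obtain ⟨r, hr⟩ := ((I.image f).finite_toSet.isBounded).exists_norm_le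
    exact ⟨r, hr⟩
  obtain ⟨Q, hQs, hQ, hmax⟩ := exists_maximal_separated hρ hr
  have hQU := hU Q (by exact_mod_cast hQs) hQ
  have hch : ∀ i, ∃ q, i ∈ I → q ∈ Q ∧ ‖f i - q‖ < ρ := by
    intro i
    by_cases hi : i ∈ I
    · obtain ⟨q, hq, h⟩ := hmax (f i) (by
        exact_mod_cast Finset.mem_image_of_mem f hi)
      exact ⟨q, fun _ => ⟨hq, h⟩⟩
    · exact ⟨0, fun h => absurd h hi⟩
  choose g hg using hch
  have hcard : (I.card : ℝ) = ∑ q ∈ Q, ((I.filter fun i => g i = q).card : ℝ) := by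
    exact_mod_cast Finset.card_eq_sum_card_fiberwise (fun i hi => (hg i hi).1)
  have hE : ∑ q ∈ Q, ((I.filter fun i => g i = q).card : ℝ) ^ 2 ≤
      ((I ×ˢ I).filter fun p => ‖f p.1 - f p.2‖ < 2 * ρ).card := by
    have hdisj : (Q : Set ℂ).PairwiseDisjoint
        (fun q => (I.filter fun i => g i = q) ×ˢ (I.filter fun i => g i = q)) := by
      intro q _ q' _ hne
      refine Finset.disjoint_left.2 fun p hp hp' => hne ?_
      simp only [Finset.mem_product, Finset.mem_filter] at hp hp'
      rw [← hp.1.2, ← hp'.1.2]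
    have hsub : (Q.biUnion fun q => (I.filter fun i => g i = q) ×ˢ (I.filter fun i => g i = q)) ⊆
        (I ×ˢ I).filter fun p => ‖f p.1 - f p.2‖ < 2 * ρ := by
      intro p hp
      simp only [Finset.mem_biUnion, Finset.mem_product, Finset.mem_filter] at hp ⊢
      obtain ⟨q, -, ⟨h1, h2⟩, h3, h4⟩ := hp
      refine ⟨⟨h1, h3⟩, ?_⟩
      have e1 := (hg p.1 h1).2
      have e2 := (hg p.2 h3).2
      rw [h2] at e1
      rw [h4] at e2
      calc ‖f p.1 - f p.2‖ = ‖(f p.1 - q) - (f p.2 - q)‖ := by ring_nf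
        _ ≤ ‖f p.1 - q‖ + ‖f p.2 - q‖ := norm_sub_le _ _
        _ < 2 * ρ := by linarith
    have := Finset.card_le_card hsub
    rw [Finset.card_biUnion hdisj] at this
    simp only [Finset.card_product] at this
    calc ∑ q ∈ Q, ((I.filter fun i => g i = q).card : ℝ) ^ 2
        = ((∑ q ∈ Q, (I.filter fun i => g i = q).card * (I.filter fun i => g i = q).card : ℕ) : ℝ) := by
          push_cast
          exact Finset.sum_congr rfl fun _ _ => by ring
      _ ≤ _ := by exact_mod_cast this
  calc (I.card : ℝ) ^ 2 = (∑ q ∈ Q, ((I.filter fun i => g i = q).card : ℝ)) ^ 2 := by rw [hcard]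
    _ ≤ Q.card * ∑ q ∈ Q, ((I.filter fun i => g i = q).card : ℝ) ^ 2 := sq_sum_le_card_mul_sum_sq
    _ ≤ U * ((I ×ˢ I).filter fun p => ‖f p.1 - f p.2‖ < 2 * ρ).card := by
        gcongr
        exact (Nat.cast_nonneg _).trans hQU

/-- If no `X + bY` contains a large separated set, and each affine relation between distinct
points of `Y` holds for few `b`, then `X` and `Y` cannot both be large. -/
theorem card_mul_card_le_of_dilates {ρ U m : ℝ} (hρ : 0 < ρ) (hU0 : 0 ≤ U) (hm : 0 ≤ m)
    {X Y B : Finset ℂ}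
    (hX : Separated (2 * ρ) X)
    (hB : ∀ y ∈ Y, ∀ y' ∈ Y, y ≠ y' → ∀ z : ℂ,
      ((B.filter fun b => ‖z + b * (y - y')‖ < 2 * ρ).card : ℝ) ≤ m)
    (hU : ∀ b ∈ B, ∀ P : Finset ℂ, (∀ z ∈ P, ∃ x ∈ X, ∃ y ∈ Y, z = x + b * y) →
      Separated ρ P → (P.card : ℝ) ≤ U) :
    (B.card : ℝ) * (X.card * Y.card) ≤ U * (B.card + m * (X.card * Y.card)) := by
  classical
  set I := X ×ˢ Y with hI
  set N : ℝ := X.card * Y.card with hN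
  have hIN : (I.card : ℝ) = N := by rw [hI, Finset.card_product]; push_cast; rfl
  have hN0 : 0 ≤ N := by positivity
  rcases hN0.eq_or_lt with h0 | hpos
  · rw [← h0]
    simp only [mul_zero, add_zero]
    positivity
  have hb : ∀ b ∈ B, N ^ 2 ≤ U * ((I ×ˢ I).filter fun p : (ℂ × ℂ) × (ℂ × ℂ) =>
      ‖(p.1.1 + b * p.1.2) - (p.2.1 + b * p.2.2)‖ < 2 * ρ).card := by
    intro b hbB
    have := card_sq_le_mul_energy hρ I (fun p => p.1 + b * p.2) (U := U) (fun P hP hs => by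
      refine hU b hbB P (fun z hz => ?_) hs
      obtain ⟨p, hp, rfl⟩ := Finset.mem_image.1 (hP hz)
      exact ⟨p.1, (Finset.mem_product.1 hp).1, p.2, (Finset.mem_product.1 hp).2, rfl⟩)
    rwa [hIN] at this
  have hsum : (∑ b ∈ B, (((I ×ˢ I).filter fun p : (ℂ × ℂ) × (ℂ × ℂ) =>
      ‖(p.1.1 + b * p.1.2) - (p.2.1 + b * p.2.2)‖ < 2 * ρ).card : ℝ)) ≤
      B.card * N + m * N ^ 2 := by
    have hswap : (∑ b ∈ B, (((I ×ˢ I).filter fun p : (ℂ × ℂ) × (ℂ × ℂ) =>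
        ‖(p.1.1 + b * p.1.2) - (p.2.1 + b * p.2.2)‖ < 2 * ρ).card : ℝ)) =
        ∑ p ∈ I ×ˢ I, ((B.filter fun b =>
          ‖(p.1.1 + b * p.1.2) - (p.2.1 + b * p.2.2)‖ < 2 * ρ).card : ℝ) := by
      exact_mod_cast Finset.sum_card_bipartiteAbove_eq_sum_card_bipartiteBelow
        (fun b (p : (ℂ × ℂ) × (ℂ × ℂ)) =>
          ‖(p.1.1 + b * p.1.2) - (p.2.1 + b * p.2.2)‖ < 2 * ρ)
    rw [hswap]
    have hterm : ∀ p ∈ I ×ˢ I, ((B.filter fun b =>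
          ‖(p.1.1 + b * p.1.2) - (p.2.1 + b * p.2.2)‖ < 2 * ρ).card : ℝ) ≤
          (if p.1 = p.2 then (B.card : ℝ) else 0) + m := by
      rintro ⟨⟨x, y⟩, ⟨x', y'⟩⟩ hp
      simp only [hI, Finset.mem_product] at hp
      obtain ⟨⟨hx, hy⟩, hx', hy'⟩ := hp
      by_cases hyy : y = y'
      · subst hyy
        by_cases hxx : x = x'
        · subst hxx
          rw [if_pos rfl]
          have : ((B.filter fun b =>
              ‖(x + b * y) - (x + b * y)‖ < 2 * ρ).card : ℝ) ≤ B.card := by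
            exact_mod_cast Finset.card_filter_le _ _
          simp only
          linarith
        · rw [Finset.filter_false_of_mem]
          · simp only [Finset.card_empty, Nat.cast_zero]
            split_ifs <;> positivity
          · intro b _
            simp only [add_sub_add_right_eq_sub, not_lt]
            exact hX x hx x' hx' hxx
      · have h1 := hB y hy y' hy' hyy (x - x')
        have h2 : (B.filter fun b => ‖(x + b * y) - (x' + b * y')‖ < 2 * ρ) =
            B.filter fun b => ‖x - x' + b * (y - y')‖ < 2 * ρ := by
          refine Finset.filter_congr fun b _ => ?_
          rw [show (x + b * y) - (x' + b * y') = x - x' + b * (y - y') by ring]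
        simp only [h2]
        split_ifs <;> linarith [(Nat.cast_nonneg B.card : (0 : ℝ) ≤ B.card)]
    refine (Finset.sum_le_sum hterm).trans ?_
    rw [Finset.sum_add_distrib, Finset.sum_const, Finset.card_product, nsmul_eq_mul,
      Finset.sum_product]
    simp only [Finset.sum_ite_eq]
    rw [Finset.sum_ite_mem, Finset.inter_self, Finset.sum_const, nsmul_eq_mul]
    push_cast
    rw [hIN]
    nlinarith
  have htot : (B.card : ℝ) * N ^ 2 ≤ U * (B.card * N + m * N ^ 2) := by
    calc (B.card : ℝ) * N ^ 2 = ∑ _b ∈ B, N ^ 2 := by rw [Finset.sum_const, nsmul_eq_mul]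
      _ ≤ ∑ b ∈ B, U * (((I ×ˢ I).filter fun p : (ℂ × ℂ) × (ℂ × ℂ) =>
            ‖(p.1.1 + b * p.1.2) - (p.2.1 + b * p.2.2)‖ < 2 * ρ).card : ℝ) :=
          Finset.sum_le_sum hb
      _ ≤ _ := by
          rw [← Finset.mul_sum]
          exact mul_le_mul_of_nonneg_left hsum hU0
  refine le_of_mul_le_mul_right ?_ hpos
  calc (B.card : ℝ) * N * N = B.card * N ^ 2 := by ring
    _ ≤ _ := htot
    _ = _ := by ring

/-! ### Sums of products -/

/-- Elements obtained from `A` and `1` by at most `n` rounds of ring operations. -/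
def ringGen (A : Set ℂ) : ℕ → Set ℂ
  | 0 => insert 1 A
  | n + 1 => {z | z ∈ ringGen A n ∨ ∃ x ∈ ringGen A n, ∃ y ∈ ringGen A n,
      z = x + y ∨ z = x - y ∨ z = x * y}

section ringGen

variable {A : Set ℂ} {n : ℕ} {x y : ℂ}

theorem ringGen_succ (h : x ∈ ringGen A n) : x ∈ ringGen A (n + 1) := Or.inl h

theorem ringGen_mono {m : ℕ} (hmn : m ≤ n) : ringGen A m ⊆ ringGen A n := by
  induction hmn with
  | refl => exact Subset.rfl
  | step _ ih => exact ih.trans fun _ h => ringGen_succ h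

theorem ringGen_add (hx : x ∈ ringGen A n) (hy : y ∈ ringGen A n) : x + y ∈ ringGen A (n + 1) :=
  Or.inr ⟨x, hx, y, hy, Or.inl rfl⟩

theorem ringGen_sub (hx : x ∈ ringGen A n) (hy : y ∈ ringGen A n) : x - y ∈ ringGen A (n + 1) :=
  Or.inr ⟨x, hx, y, hy, Or.inr (Or.inl rfl)⟩

theorem ringGen_mul (hx : x ∈ ringGen A n) (hy : y ∈ ringGen A n) : x * y ∈ ringGen A (n + 1) :=
  Or.inr ⟨x, hx, y, hy, Or.inr (Or.inr rfl)⟩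

theorem one_mem_ringGen (A : Set ℂ) (n : ℕ) : (1 : ℂ) ∈ ringGen A n :=
  ringGen_mono (Nat.zero_le n) (mem_insert 1 A)

theorem mem_ringGen_of_mem (h : x ∈ A) (n : ℕ) : x ∈ ringGen A n :=
  ringGen_mono (Nat.zero_le n) (mem_insert_of_mem 1 h)

theorem zero_mem_ringGen (A : Set ℂ) (n : ℕ) : (0 : ℂ) ∈ ringGen A (n + 1) := by
  simpa using ringGen_sub (one_mem_ringGen A n) (one_mem_ringGen A n)

theorem norm_le_of_mem_ringGen {M : ℝ} (hM : 2 ≤ M) (hA : ∀ a ∈ A, ‖a‖ ≤ M) :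
    ∀ n, ∀ x ∈ ringGen A n, ‖x‖ ≤ M ^ 2 ^ n := by
  intro n
  induction n with
  | zero =>
    rintro x (rfl | hx)
    · rw [norm_one]
      simpa using (by linarith : (1 : ℝ) ≤ M)
    · simpa using hA x hx
  | succ n ih =>
    have h1 : M ≤ M ^ 2 ^ n := le_self_pow₀ (by linarith) (by positivity)
    have h2 : M ^ 2 ^ (n + 1) = M ^ 2 ^ n * M ^ 2 ^ n := by rw [pow_succ, mul_two, pow_add]
    have h3 : 2 * M ^ 2 ^ n ≤ M ^ 2 ^ (n + 1) := by
      rw [h2]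
      nlinarith
    rintro z (hz | ⟨x, hx, y, hy, rfl | rfl | rfl⟩)
    · have := ih z hz
      linarith
    · have := norm_add_le x y
      linarith [ih x hx, ih y hy]
    · have := norm_sub_le x y
      linarith [ih x hx, ih y hy]
    · rw [norm_mul, h2]
      exact mul_le_mul (ih x hx) (ih y hy) (norm_nonneg _) (by linarith)

end ringGen

/-! ### Dimension increment at a fixed scale -/

section Increment

variable {A : Set ℂ} {s : ℕ} {δ α c U R d : ℝ}

theorem local_card_le (hδ : 0 < δ)
    (hlow : ∀ ρ, δ ≤ ρ → PackGE ρ (ringGen A s) (c * ρ ^ (-α)))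
    (hup : ∀ P : Finset ℂ, (P : Set ℂ) ⊆ ringGen A (s + 6) → Separated δ P → (P.card : ℝ) ≤ U)
    {r : ℝ} (hr : δ ≤ r) {P : Finset ℂ} (hP : (P : Set ℂ) ⊆ ringGen A (s + 5))
    (hPs : Separated δ P) (hPr : ∀ x ∈ P, ‖x‖ ≤ r) :
    c * (4 * r) ^ (-α) * P.card ≤ U := by
  obtain ⟨Q, hQ, hQs, hc⟩ := hlow (4 * r) (by linarith)
  obtain ⟨h1, h2⟩ := separated_image hδ (Q ×ˢ P) (fun p => p.1 + p.2) (by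
    rintro ⟨q, p⟩ hqp ⟨q', p'⟩ hqp' hne
    obtain ⟨hq, hp⟩ := Finset.mem_product.1 hqp
    obtain ⟨hq', hp'⟩ := Finset.mem_product.1 hqp'
    simp only at hq hp hq' hp' ⊢
    by_cases hqq : q = q'
    · subst hqq
      rw [add_sub_add_left_eq_sub]
      exact hPs p hp p' hp' (fun e => hne (by rw [e]))
    · have e1 := hQs q hq q' hq' hqq
      have e2 : ‖q - q'‖ ≤ ‖q + p - (q' + p')‖ + ‖p - p'‖ := by
        calc ‖q - q'‖ = ‖(q + p - (q' + p')) - (p - p')‖ := by ring_nf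
          _ ≤ _ := norm_sub_le _ _
      have e3 := (norm_sub_le p p').trans (add_le_add (hPr p hp) (hPr p' hp'))
      linarith)
  have h3 := hup _ (by
    intro z hz
    obtain ⟨p, hp, rfl⟩ := Finset.mem_image.1 (Finset.mem_coe.1 hz)
    obtain ⟨hq, hp⟩ := Finset.mem_product.1 hp
    exact ringGen_add (ringGen_mono (by omega) (hQ hq)) (hP hp)) h1
  rw [h2, Finset.card_product] at h3
  push_cast at h3
  exact (mul_le_mul_of_nonneg_right hc (Nat.cast_nonneg _)).trans h3

/-- Every bounded quotient with a denominator of size at least `d` is close to a quotient of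
differences of elements of `ringGen A s` whose denominator is again of size at least `d`. -/
theorem exists_near_quotient (hδ : 0 < δ) (hδd : δ ≤ d) (hR : 1 ≤ R) (hc : 0 < c)
    (hlow : ∀ ρ, δ ≤ ρ → PackGE ρ (ringGen A s) (c * ρ ^ (-α)))
    (hup : ∀ P : Finset ℂ, (P : Set ℂ) ⊆ ringGen A (s + 6) → Separated δ P → (P.card : ℝ) ≤ U)
    (hbd : ∀ x ∈ ringGen A (s + 6), ‖x‖ ≤ R)
    (hU : U < c ^ 3 * (4 * R ^ 2 * (1 + 4 * R) * (δ * d)) ^ (-α))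
    {p q : ℂ} (hp : p ∈ ringGen A (s + 3)) (hq : q ∈ ringGen A (s + 3)) (hqd : d ≤ ‖q‖)
    (hpq : ‖p / q‖ ≤ 4 * R) :
    ∃ p' ∈ ringGen A (s + 1), ∃ q' ∈ ringGen A (s + 1), d ≤ ‖q'‖ ∧
      ‖p / q - p' / q'‖ ≤ R * δ / d ^ 2 := by
  by_contra hcon
  push Not at hcon
  have hd : 0 < d := hδ.trans_le hδd
  have hq0 : 0 < ‖q‖ := hd.trans_le hqd
  have hqne : q ≠ 0 := norm_pos_iff.1 hq0
  set b := p / q with hb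
  set t := R * δ / ‖q‖ with ht
  have htpos : 0 < t := by positivity
  have htδ : δ ≤ t := by
    rw [ht, le_div_iff₀ hq0]
    have := hbd q (ringGen_mono (by omega) hq)
    nlinarith
  obtain ⟨X, hX, hXs, hXc⟩ := hlow t htδ
  obtain ⟨Y, hY, hYs, hYc⟩ := hlow d hδd
  have hsep : ∀ i ∈ X ×ˢ Y, ∀ j ∈ X ×ˢ Y, i ≠ j →
      δ ≤ ‖(q * i.1 + p * i.2) - (q * j.1 + p * j.2)‖ := by
    rintro ⟨x, y⟩ h1 ⟨x', y'⟩ h2 hne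
    obtain ⟨hx, hy⟩ := Finset.mem_product.1 h1
    obtain ⟨hx', hy'⟩ := Finset.mem_product.1 h2
    simp only at hx hy hx' hy' ⊢
    have key : t ≤ ‖(x - x') + b * (y - y')‖ := by
      by_cases hyy : y = y'
      · subst hyy
        rw [sub_self, mul_zero, add_zero]
        exact hXs x hx x' hx' (fun e => hne (by rw [e]))
      · have hyd := hYs y hy y' hy' hyy
        have hypos : 0 < ‖y - y'‖ := hd.trans_le hyd
        have hyne : y - y' ≠ 0 := norm_pos_iff.1 hypos
        have h3 := hcon (x' - x) (ringGen_sub (hX hx') (hX hx)) (y - y')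
          (ringGen_sub (hY hy) (hY hy')) hyd
        have h4 : (x - x') + b * (y - y') = (b - (x' - x) / (y - y')) * (y - y') := by
          field_simp
          ring
        rw [h4, norm_mul]
        calc t ≤ R * δ / d := by
              rw [ht]
              gcongr
          _ = R * δ / d ^ 2 * d := by field_simp
          _ ≤ _ := mul_le_mul h3.le hyd hd.le (norm_nonneg _)
    have h5 : (q * x + p * y) - (q * x' + p * y') = q * ((x - x') + b * (y - y')) := by
      rw [hb]
      field_simp
      ring
    rw [h5, norm_mul]
    calc δ ≤ R * δ := by nlinarith
      _ = ‖q‖ * t := by rw [ht]; field_simp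
      _ ≤ _ := mul_le_mul_of_nonneg_left key hq0.le
  obtain ⟨h1, h2⟩ := separated_image hδ (X ×ˢ Y) (fun i => q * i.1 + p * i.2) hsep
  have hpn : ‖p‖ ≤ 4 * R * ‖q‖ := by
    rw [hb, norm_div, div_le_iff₀ hq0] at hpq
    exact hpq
  have hr : δ ≤ ‖q‖ * R * (1 + 4 * R) := by
    have : (1 : ℝ) ≤ R * (1 + 4 * R) := by nlinarith
    calc δ ≤ ‖q‖ := hδd.trans hqd
      _ ≤ ‖q‖ * (R * (1 + 4 * R)) := le_mul_of_one_le_right hq0.le this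
      _ = _ := by ring
  have hmem : ∀ z ∈ (X ×ˢ Y).image (fun i => q * i.1 + p * i.2),
      z ∈ ringGen A (s + 5) ∧ ‖z‖ ≤ ‖q‖ * R * (1 + 4 * R) := by
    intro z hz
    obtain ⟨i, hi, rfl⟩ := Finset.mem_image.1 hz
    obtain ⟨hx, hy⟩ := Finset.mem_product.1 hi
    refine ⟨?_, ?_⟩
    · have e1 : i.1 ∈ ringGen A (s + 3) := ringGen_mono (by omega) (hX hx)
      have e2 : i.2 ∈ ringGen A (s + 3) := ringGen_mono (by omega) (hY hy)
      exact ringGen_add (ringGen_mul hq e1) (ringGen_mul hp e2)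
    · have e1 := hbd i.1 (ringGen_mono (by omega) (hX hx))
      have e2 := hbd i.2 (ringGen_mono (by omega) (hY hy))
      have e3 := norm_add_le (q * i.1) (p * i.2)
      rw [norm_mul, norm_mul] at e3
      calc ‖q * i.1 + p * i.2‖ ≤ ‖q‖ * ‖i.1‖ + ‖p‖ * ‖i.2‖ := e3
        _ ≤ ‖q‖ * R + (4 * R * ‖q‖) * R := by gcongr
        _ = _ := by ring
  have hmain := local_card_le hδ hlow hup hr (fun z hz => (hmem z hz).1) h1
    (fun z hz => (hmem z hz).2)
  rw [h2, Finset.card_product] at hmain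
  push_cast at hmain
  have hcard : c * t ^ (-α) * (c * d ^ (-α)) ≤ (X.card : ℝ) * Y.card :=
    mul_le_mul hXc hYc (by positivity) (Nat.cast_nonneg _)
  have hprod : (4 * R ^ 2 * (1 + 4 * R) * (δ * d)) ^ (-α) =
      (4 * (‖q‖ * R * (1 + 4 * R))) ^ (-α) * t ^ (-α) * d ^ (-α) := by
    rw [← Real.mul_rpow (by positivity) (by positivity),
      ← Real.mul_rpow (by positivity) (by positivity)]
    congr 1
    rw [ht]
    field_simp
  have hfin : c ^ 3 * (4 * R ^ 2 * (1 + 4 * R) * (δ * d)) ^ (-α) ≤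
      c * (4 * (‖q‖ * R * (1 + 4 * R))) ^ (-α) * (X.card * Y.card) := by
    calc c ^ 3 * (4 * R ^ 2 * (1 + 4 * R) * (δ * d)) ^ (-α)
        = c * (4 * (‖q‖ * R * (1 + 4 * R))) ^ (-α) * (c * t ^ (-α) * (c * d ^ (-α))) := by
          rw [hprod]
          ring
      _ ≤ _ := by gcongr
  linarith

/-- The quotients with denominators of size at least `d` are dense in a parallelogram. -/
theorem exists_quotient_near_parallelogram (hδ : 0 < δ) (hδd : δ ≤ d) (hd1 : d ≤ 1)
    (hR : 1 ≤ R) (hc : 0 < c)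
    (hlow : ∀ ρ, δ ≤ ρ → PackGE ρ (ringGen A s) (c * ρ ^ (-α)))
    (hup : ∀ P : Finset ℂ, (P : Set ℂ) ⊆ ringGen A (s + 6) → Separated δ P → (P.card : ℝ) ≤ U)
    (hbd : ∀ x ∈ ringGen A (s + 6), ‖x‖ ≤ R)
    (hU : U < c ^ 3 * (4 * R ^ 2 * (1 + 4 * R) * (δ * d)) ^ (-α))
    (hsmall : R * δ / d ^ 2 ≤ R / 2)
    {a : ℂ} (ha : a ∈ A) (x y : ℝ) (hx : x ∈ Icc (0 : ℝ) 1) (hy : y ∈ Icc (0 : ℝ) 1) :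
    ∃ p ∈ ringGen A (s + 1), ∃ q ∈ ringGen A (s + 1), d ≤ ‖q‖ ∧
      ‖(x + y * a : ℂ) - p / q‖ ≤ 3 * (R * δ / d ^ 2) := by
  have hd : 0 < d := hδ.trans_le hδd
  set ρ := R * δ / d ^ 2 with hρ
  have hρpos : 0 < ρ := by positivity
  have haR : ‖a‖ ≤ R := hbd a (mem_ringGen_of_mem ha _)
  have hnorm : ∀ x y : ℝ, x ∈ Icc (0 : ℝ) 1 → y ∈ Icc (0 : ℝ) 1 →
      ‖(x + y * a : ℂ)‖ ≤ 2 * R := by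
    intro x y hx hy
    calc ‖(x + y * a : ℂ)‖ ≤ ‖(x : ℂ)‖ + ‖(y : ℂ)‖ * ‖a‖ := by
          refine (norm_add_le _ _).trans ?_
          rw [norm_mul]
      _ ≤ 1 + 1 * R := by
          rw [Complex.norm_of_nonneg hx.1, Complex.norm_of_nonneg hy.1]
          gcongr
          · exact hx.2
          · exact hy.2
      _ ≤ 2 * R := by linarith
  have key : ∀ n : ℕ, ∀ x y : ℝ, x ∈ Icc (0 : ℝ) 1 → y ∈ Icc (0 : ℝ) 1 →
      ∃ p ∈ ringGen A (s + 1), ∃ q ∈ ringGen A (s + 1), d ≤ ‖q‖ ∧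
      ‖(x + y * a : ℂ) - p / q‖ ≤ 2 * ρ + 2 * R * (1 / 2) ^ n := by
    intro n
    induction n with
    | zero =>
      intro x y hx hy
      refine ⟨0, zero_mem_ringGen A s, 1, one_mem_ringGen A _, by simpa using hd1, ?_⟩
      rw [zero_div, sub_zero, pow_zero, mul_one]
      linarith [hnorm x y hx hy]
    | succ n ih =>
      intro x y hx hy
      have hhalf : ∀ u : ℝ, u ∈ Icc (0 : ℝ) 1 →
          ∃ v : ℝ, (v = 0 ∨ v = 1) ∧ ∃ u' ∈ Icc (0 : ℝ) 1, u = (v + u') / 2 := by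
        intro u hu
        rcases le_total u (1 / 2) with h | h
        · exact ⟨0, Or.inl rfl, 2 * u, ⟨by linarith [hu.1], by linarith⟩, by ring⟩
        · exact ⟨1, Or.inr rfl, 2 * u - 1, ⟨by linarith, by linarith [hu.2]⟩, by ring⟩
      obtain ⟨v, hv, x', hx', hxx⟩ := hhalf x hx
      obtain ⟨w, hw, y', hy', hyy⟩ := hhalf y hy
      obtain ⟨p, hp, q, hq, hqd, hpq⟩ := ih x' y' hx' hy'
      have hqne : q ≠ 0 := norm_pos_iff.1 (hd.trans_le hqd)
      have hv01 : v ∈ Icc (0 : ℝ) 1 := by rcases hv with rfl | rfl <;> simp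
      have hw01 : w ∈ Icc (0 : ℝ) 1 := by rcases hw with rfl | rfl <;> simp
      have hvert : (v + w * a : ℂ) ∈ ringGen A (s + 1) := by
        have h1 := one_mem_ringGen A s
        have h2 := mem_ringGen_of_mem ha s
        rcases hv with rfl | rfl <;> rcases hw with rfl | rfl
        · simpa using zero_mem_ringGen A s
        · simpa using ringGen_succ h2
        · simpa using one_mem_ringGen A (s + 1)
        · simpa using ringGen_add h1 h2
      have hb2 : ‖p / q‖ ≤ 5 * R := by
        have e1 := hnorm x' y' hx' hy'
        have e2 : ‖p / q‖ ≤ ‖(x' + y' * a : ℂ)‖ + ‖(x' + y' * a : ℂ) - p / q‖ := by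
          calc ‖p / q‖ = ‖(x' + y' * a : ℂ) - ((x' + y' * a : ℂ) - p / q)‖ := by ring_nf
            _ ≤ _ := norm_sub_le _ _
        have e3 : (1 / 2 : ℝ) ^ n ≤ 1 := pow_le_one₀ (by norm_num) (by norm_num)
        nlinarith
      have hmid : ((v + w * a) * q + p) / (q + q) = ((v + w * a) + p / q) / 2 := by
        field_simp
        ring
      obtain ⟨p', hp', q', hq', hq'd, hnear⟩ := exists_near_quotient hδ hδd hR hc hlow hup hbd hU
        (p := (v + w * a) * q + p) (q := q + q)
        (ringGen_add (ringGen_mul hvert hq) (ringGen_succ hp))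
        (ringGen_succ (ringGen_add hq hq))
        (by
          rw [← two_mul, norm_mul, Complex.norm_ofNat]
          linarith)
        (by
          rw [hmid, norm_div, Complex.norm_ofNat]
          have := norm_add_le (v + w * a : ℂ) (p / q)
          linarith [hnorm v w hv01 hw01])
      refine ⟨p', hp', q', hq', hq'd, ?_⟩
      have e : (x + y * a : ℂ) - p' / q' =
          ((x' + y' * a : ℂ) - p / q) / 2 +
            (((v + w * a) * q + p) / (q + q) - p' / q') := by
        rw [hmid, hxx, hyy]
        push_cast
        ring
      rw [e]
      refine (norm_add_le _ _).trans ?_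
      rw [norm_div, Complex.norm_ofNat, pow_succ]
      linarith
  obtain ⟨n, hn⟩ := exists_pow_lt_of_lt_one (show 0 < ρ / (2 * R) by positivity)
    (show (1 / 2 : ℝ) < 1 by norm_num)
  obtain ⟨p, hp, q, hq, hqd, h⟩ := key n x y hx hy
  refine ⟨p, hp, q, hq, hqd, h.trans ?_⟩
  rw [lt_div_iff₀ (by positivity)] at hn
  linarith

end Increment

section Increment

variable {A : Set ℂ} {s : ℕ} {δ α c U R d : ℝ}

theorem separated_lattice {a : ℂ} {β : ℝ} (hβ : 0 < β) (hβ1 : β ≤ 1) (ha : β ≤ |a.im|)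
    {n : ℕ} (hn : 0 < n) :
    ∀ i ∈ Finset.range n ×ˢ Finset.range n, ∀ j ∈ Finset.range n ×ˢ Finset.range n, i ≠ j →
      β / n ≤ ‖(((i.1 / n : ℝ) : ℂ) + ((i.2 / n : ℝ) : ℂ) * a) -
        (((j.1 / n : ℝ) : ℂ) + ((j.2 / n : ℝ) : ℂ) * a)‖ := by
  rintro ⟨i, k⟩ - ⟨j, l⟩ - hne
  have hn' : (0 : ℝ) < n := by exact_mod_cast hn
  have habs : ∀ u v : ℕ, u ≠ v → (1 : ℝ) ≤ |(u : ℝ) - v| := by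
    intro u v huv
    have : (1 : ℤ) ≤ |(u : ℤ) - v| := Int.one_le_abs (sub_ne_zero.2 (by exact_mod_cast huv))
    exact_mod_cast this
  simp only
  by_cases hkl : k = l
  · subst hkl
    have hij : i ≠ j := fun e => hne (by rw [e])
    rw [add_sub_add_right_eq_sub, ← Complex.ofReal_sub, Complex.norm_real, Real.norm_eq_abs,
      ← sub_div, abs_div, abs_of_pos hn']
    gcongr
    linarith [habs i j hij]
  · refine le_trans ?_ (Complex.abs_im_le_norm _)
    have e : ((((i / n : ℝ) : ℂ) + ((k / n : ℝ) : ℂ) * a) -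
        (((j / n : ℝ) : ℂ) + ((l / n : ℝ) : ℂ) * a)).im = ((k : ℝ) - l) * a.im / n := by
      simp only [Complex.sub_im, Complex.add_im, Complex.ofReal_im, Complex.im_ofReal_mul, zero_add]
      ring
    rw [e, abs_div, abs_of_pos hn', abs_mul]
    gcongr
    nlinarith [habs k l hkl, abs_nonneg a.im]

/-- A set of sums of products that looks `α`-dimensional at every scale above `δ` cannot have a
small `δ`-packing number. -/
theorem false_of_packing_le (hδ : 0 < δ) (hδd : δ ≤ d) (hd1 : d ≤ 1)
    (hR : 1 ≤ R) (hc : 0 < c)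
    (hlow : ∀ ρ, δ ≤ ρ → PackGE ρ (ringGen A s) (c * ρ ^ (-α)))
    (hup : ∀ P : Finset ℂ, (P : Set ℂ) ⊆ ringGen A (s + 6) → Separated δ P → (P.card : ℝ) ≤ U)
    (hbd : ∀ x ∈ ringGen A (s + 6), ‖x‖ ≤ R)
    (hU : U < c ^ 3 * (4 * R ^ 2 * (1 + 4 * R) * (δ * d)) ^ (-α))
    (hsmall : R * δ / d ^ 2 ≤ R / 2)
    {a : ℂ} (ha : a ∈ A) {β θ ρ : ℝ} (hβ : 0 < β) (hβ1 : β ≤ 1) (haβ : β ≤ |a.im|)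
    (hδθ : δ ≤ θ) (hθ1 : θ ≤ 1) (hρ : ρ = 12 * R * (R * δ / d ^ 2))
    (hU2 : 2 * U ≤ c ^ 2 * (2 * ρ * θ) ^ (-α))
    (hU3 : U * (8 * ρ / (θ * β)) ^ 2 < 1 / 2) : False := by
  classical
  have hd : 0 < d := hδ.trans_le hδd
  have hθ : 0 < θ := hδ.trans_le hδθ
  set ρ₀ := R * δ / d ^ 2 with hρ₀
  have hρ₀pos : 0 < ρ₀ := by positivity
  have hρpos : 0 < ρ := by rw [hρ]; positivity
  have hδρ₀ : δ ≤ ρ₀ * d := by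
    rw [hρ₀, div_mul_eq_mul_div, le_div_iff₀ (by positivity)]
    nlinarith [mul_pos hδ hd]
  have hδρ : δ ≤ 2 * ρ := by
    rw [hρ]
    nlinarith [mul_le_of_le_one_right hρ₀pos.le hd1]
  obtain ⟨X, hX, hXs, hXc⟩ := hlow (2 * ρ) hδρ
  obtain ⟨Y, hY, hYs, hYc⟩ := hlow θ hδθ
  obtain ⟨n, hn⟩ := exists_nat_ge (1 / ρ)
  have hn' : (0 : ℝ) < n := lt_of_lt_of_le (by positivity) hn
  have hn0 : 0 < n := by exact_mod_cast hn'
  rw [div_le_iff₀ hρpos] at hn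
  have hU0 : 0 ≤ U := (Nat.cast_nonneg _).trans (hup ∅ (by simp) (fun x hx => by simp at hx))
  set g : ℕ × ℕ → ℂ := fun i => ((i.1 / n : ℝ) : ℂ) + ((i.2 / n : ℝ) : ℂ) * a with hg
  obtain ⟨hBs, hBc⟩ := separated_image (show 0 < β / n by positivity)
    (Finset.range n ×ˢ Finset.range n) g (separated_lattice hβ hβ1 haβ hn0)
  set B := (Finset.range n ×ˢ Finset.range n).image g with hB
  rw [Finset.card_product, Finset.card_range] at hBc
  have hBcard : (B.card : ℝ) = (n : ℝ) ^ 2 := by rw [hBc]; push_cast; ring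
  have hcount : ∀ y ∈ Y, ∀ y' ∈ Y, y ≠ y' → ∀ z : ℂ,
      ((B.filter fun b => ‖z + b * (y - y')‖ < 2 * ρ).card : ℝ) ≤
        (8 * ρ / (θ * β)) ^ 2 * (n : ℝ) ^ 2 := by
    intro y hy y' hy' hne z
    have hyθ := hYs y hy y' hy' hne
    have hypos : 0 < ‖y - y'‖ := hθ.trans_le hyθ
    have hyne : y - y' ≠ 0 := norm_pos_iff.1 hypos
    refine ((hBs.subset (Finset.filter_subset _ _)).card_le (by positivity)
      (c := -(z / (y - y'))) (r := 2 * ρ / θ) (by positivity) fun b hb => ?_).trans ?_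
    · have hb2 := (Finset.mem_filter.1 hb).2
      have e : b - -(z / (y - y')) = (z + b * (y - y')) / (y - y') := by
        field_simp
        ring
      rw [e, norm_div]
      exact div_le_div₀ (by positivity) hb2.le hθ hyθ
    · rw [← mul_pow]
      have h1 : 1 ≤ 4 * ρ / (θ * β) * n := by
        rw [div_mul_eq_mul_div, le_div_iff₀ (by positivity)]
        nlinarith [mul_le_one₀ hθ1 hβ.le hβ1]
      have h2 : 2 * (2 * ρ / θ) / (β / n) = 4 * ρ / (θ * β) * n := by
        field_simp
        ring
      have h3 : 8 * ρ / (θ * β) * n = 2 * (4 * ρ / (θ * β) * n) := by ring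
      rw [h2, h3]
      gcongr
      linarith
  have hdil : ∀ b ∈ B, ∀ P : Finset ℂ, (∀ z ∈ P, ∃ x ∈ X, ∃ y ∈ Y, z = x + b * y) →
      Separated ρ P → (P.card : ℝ) ≤ U := by
    intro b hb P hP hPs
    obtain ⟨⟨j, k⟩, hjk, rfl⟩ := Finset.mem_image.1 hb
    obtain ⟨hj, hk⟩ := Finset.mem_product.1 hjk
    have hunit : ∀ j : ℕ, j ∈ Finset.range n → (j / n : ℝ) ∈ Icc (0 : ℝ) 1 := by
      intro j hj
      refine ⟨by positivity, ?_⟩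
      rw [div_le_one hn']
      exact_mod_cast (Finset.mem_range.1 hj).le
    obtain ⟨p, hp, q, hq, hqd, hpq⟩ := exists_quotient_near_parallelogram hδ hδd hd1 hR hc hlow
      hup hbd hU hsmall ha (j / n : ℝ) (k / n : ℝ) (hunit j hj) (hunit k hk)
    have hq0 : 0 < ‖q‖ := hd.trans_le hqd
    have hqne : q ≠ 0 := norm_pos_iff.1 hq0
    choose! x hx y hy hxy using hP
    have hmem : ∀ z ∈ P, q * x z + p * y z ∈ ringGen A (s + 6) := by
      intro z hz
      have e1 : x z ∈ ringGen A (s + 1) := ringGen_succ (hX (hx z hz))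
      have e2 : y z ∈ ringGen A (s + 1) := ringGen_succ (hY (hy z hz))
      have e3 : q * x z + p * y z ∈ ringGen A (s + 1 + 1 + 1) :=
        ringGen_add (ringGen_mul hq e1) (ringGen_mul hp e2)
      exact ringGen_mono (by omega) e3
    have hclose : ∀ z ∈ P, ‖z - (q * x z + p * y z) / q‖ ≤ 3 * ρ₀ * R := by
      intro z hz
      have e1 : z - (q * x z + p * y z) / q = (g (j, k) - p / q) * y z := by
        have e0 := hxy z hz
        field_simp
        linear_combination q * e0
      rw [e1, norm_mul]
      exact mul_le_mul hpq (hbd _ (ringGen_mono (by omega) (hY (hy z hz)))) (norm_nonneg _)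
        (by positivity)
    obtain ⟨h1, h2⟩ := separated_image hδ P (fun z => q * x z + p * y z) (by
      intro z hz z' hz' hne
      have e1 := hPs z hz z' hz' hne
      have e2 := hclose z hz
      have e3 := hclose z' hz'
      set u := q * x z + p * y z
      set u' := q * x z' + p * y z'
      have e4 : ‖z - z'‖ ≤ ‖z - u / q‖ + ‖z' - u' / q‖ + ‖(u - u') / q‖ := by
        calc ‖z - z'‖ = ‖((z - u / q) - (z' - u' / q)) + (u - u') / q‖ := by ring_nf
          _ ≤ ‖(z - u / q) - (z' - u' / q)‖ + ‖(u - u') / q‖ := norm_add_le _ _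
          _ ≤ _ := by gcongr; exact norm_sub_le _ _
      have e5 : 6 * ρ₀ * R ≤ ‖(u - u') / q‖ := by
        rw [hρ] at e1
        linarith
      rw [norm_div, le_div_iff₀ hq0] at e5
      have e6 : ρ₀ * d ≤ 6 * ρ₀ * R * ‖q‖ := by
        have : ρ₀ ≤ 6 * ρ₀ * R := by nlinarith
        exact mul_le_mul this hqd hd.le (by positivity)
      linarith)
    rw [← h2]
    refine hup _ (fun z hz => ?_) h1
    obtain ⟨w, hw, rfl⟩ := Finset.mem_image.1 (Finset.mem_coe.1 hz)
    exact hmem w hw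
  have hfinal := card_mul_card_le_of_dilates hρpos hU0 (by positivity) hXs hcount hdil
  rw [hBcard] at hfinal
  set N : ℝ := X.card * Y.card with hN
  have hNlow : c ^ 2 * (2 * ρ * θ) ^ (-α) ≤ N := by
    rw [Real.mul_rpow (by positivity) hθ.le]
    calc c ^ 2 * ((2 * ρ) ^ (-α) * θ ^ (-α)) = (c * (2 * ρ) ^ (-α)) * (c * θ ^ (-α)) := by ring
      _ ≤ N := mul_le_mul hXc hYc (by positivity) (Nat.cast_nonneg _)
  have hNpos : 0 < N := lt_of_lt_of_le (by positivity) hNlow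
  have h1 : N ≤ U * (1 + (8 * ρ / (θ * β)) ^ 2 * N) := by
    refine le_of_mul_le_mul_left ?_ (show (0 : ℝ) < (n : ℝ) ^ 2 by positivity)
    calc (n : ℝ) ^ 2 * N ≤ _ := hfinal
      _ = _ := by ring
  have h2 : U * (8 * ρ / (θ * β)) ^ 2 * N < 1 / 2 * N := mul_lt_mul_of_pos_right hU3 hNpos
  linarith

end Increment

/-! ### Asymptotic form of the increment -/

open Filter Topology in
theorem eventually_mul_rpow_lt (C : ℝ) {e b : ℝ} (he : 0 < e) (hb : 0 < b) :
    ∀ᶠ δ : ℝ in 𝓝[>] 0, C * δ ^ e < b := by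
  have h : Tendsto (fun δ : ℝ => C * δ ^ e) (𝓝 0) (𝓝 (C * 0 ^ e)) :=
    ((Real.continuousAt_rpow_const 0 e (Or.inr he.le)).tendsto).const_mul C
  rw [Real.zero_rpow he.ne', mul_zero] at h
  exact (h.mono_left nhdsWithin_le_nhds).eventually (gt_mem_nhds hb)

/-- The hypotheses on the set of multipliers. -/
structure Ample (κ ε δ : ℝ) (A : Set ℂ) : Prop where
  norm_le : ∀ a ∈ A, ‖a‖ ≤ δ ^ (-ε)
  le_coverNum : ∀ ρ, δ ≤ ρ → δ ^ ε * ρ ^ (-κ) ≤ (coverNum ρ A : ℝ)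
  exists_im : ∃ a ∈ A, δ ^ ε ≤ |a.im|

theorem Ample.change {κ ε δ ε' δ' : ℝ} {A : Set ℂ} (h : Ample κ ε δ A) (hδ : 0 < δ)
    (hδ' : δ ≤ δ') (hε : δ' ^ ε' ≤ δ ^ ε) : Ample κ ε' δ' A where
  norm_le a ha := by
    refine (h.norm_le a ha).trans ?_
    rw [Real.rpow_neg hδ.le, Real.rpow_neg (hδ.le.trans hδ')]
    exact inv_anti₀ (Real.rpow_pos_of_pos (hδ.trans_le hδ') _) hε
  le_coverNum ρ hρ := by
    refine le_trans ?_ (h.le_coverNum ρ (hδ'.trans hρ))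
    exact mul_le_mul_of_nonneg_right hε (Real.rpow_nonneg ((hδ.le.trans hδ').trans hρ) _)
  exists_im := by
    obtain ⟨a, ha, him⟩ := h.exists_im
    exact ⟨a, ha, hε.trans him⟩

open Filter Topology in
/-- Bounded sums of products of ample sets have dimension at least `α` at the finest scale. -/
def Generates (κ α : ℝ) : Prop :=
  ∀ η > 0, ∃ s : ℕ, ∃ ε > 0, ∀ᶠ δ : ℝ in 𝓝[>] 0, ∀ A : Set ℂ, Ample κ ε δ A →
    PackGE δ (ringGen A s) (δ ^ (η - α))

theorem PackGE.mono {ρ M M' : ℝ} {S : Set ℂ} (h : PackGE ρ S M) (hM : M' ≤ M) :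
    PackGE ρ S M' := by
  obtain ⟨P, h1, h2, h3⟩ := h
  exact ⟨P, h1, h2, hM.trans h3⟩

open Filter Topology in
theorem eventually_Ioo_zero {b : ℝ} (hb : 0 < b) : ∀ᶠ δ : ℝ in 𝓝[>] 0, 0 < δ ∧ δ < b :=
  Ioo_mem_nhdsGT hb

open Filter Topology in
theorem generates_base {κ : ℝ} : Generates κ κ := by
  intro η hη
  refine ⟨0, η, hη, ?_⟩
  filter_upwards [eventually_Ioo_zero one_pos] with δ hδ A hA
  have hb := hA.le_coverNum δ le_rfl
  rw [← Real.rpow_add hδ.1] at hb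
  obtain ⟨P, h1, h2, h3⟩ := packGE_coverNum hδ.1 hA.norm_le
  exact ⟨P, fun x hx => mem_insert_of_mem 1 (h1 hx), h2, (hb.trans h3)⟩

open Filter Topology in
/-- Lower bounds at the finest scale give lower bounds at all scales. -/
theorem Generates.all_scales {κ α τ : ℝ} (h : Generates κ α) (hα0 : 0 ≤ α) (hα : α ≤ 2)
    (hτ : 0 < τ) :
    ∃ s : ℕ, ∃ ε₀ > 0, ∀ ε, 0 < ε → ε ≤ ε₀ → ∀ᶠ δ : ℝ in 𝓝[>] 0, ∀ A : Set ℂ,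
      Ample κ ε δ A → ∀ ρ, δ ≤ ρ → PackGE ρ (ringGen A s) (δ ^ τ * ρ ^ (-α)) := by
  obtain ⟨s, ε₁, hε₁, hev⟩ := h τ hτ
  obtain ⟨b, hb, hsub⟩ := mem_nhdsGT_iff_exists_Ioo_subset.1 hev
  have hb0 : (0 : ℝ) < b := hb
  refine ⟨s, ε₁ * (τ / 2), by positivity, fun ε hε hε₀ => ?_⟩
  filter_upwards [eventually_Ioo_zero one_pos,
    eventually_mul_rpow_lt 1 (show 0 < τ / 2 by positivity) hb0] with δ hδ hδb A hA ρ hρ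
  rw [one_mul] at hδb
  have hρ0 : 0 < ρ := hδ.1.trans_le hρ
  rcases lt_or_ge ρ (δ ^ (τ / 2)) with hlt | hge
  · have hmem : ρ ∈ Ioo 0 b := ⟨hρ0, hlt.trans hδb⟩
    have hA' : Ample κ ε₁ ρ A := hA.change hδ.1 hρ (by
      calc ρ ^ ε₁ ≤ (δ ^ (τ / 2)) ^ ε₁ := Real.rpow_le_rpow hρ0.le hlt.le hε₁.le
        _ = δ ^ (ε₁ * (τ / 2)) := by rw [← Real.rpow_mul hδ.1.le, mul_comm]
        _ ≤ δ ^ ε := Real.rpow_le_rpow_of_exponent_ge hδ.1 hδ.2.le hε₀)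
    refine (hsub hmem A hA').mono ?_
    rw [sub_eq_add_neg, Real.rpow_add hρ0]
    gcongr
    exact hδ.1.le
  · refine ⟨{1}, ?_, ?_, ?_⟩
    · rw [Finset.coe_singleton, singleton_subset_iff]
      exact one_mem_ringGen A s
    · intro x hx y hy hxy
      rw [Finset.mem_singleton] at hx hy
      exact absurd (hx.trans hy.symm) hxy
    · rw [Finset.card_singleton, Nat.cast_one]
      calc δ ^ τ * ρ ^ (-α) ≤ δ ^ τ * (δ ^ (τ / 2)) ^ (-α) := by
            gcongr ?_ * ?_
            · exact (Real.rpow_pos_of_pos hδ.1 _).le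
            · exact Real.rpow_le_rpow_of_nonpos (Real.rpow_pos_of_pos hδ.1 _) hge (by linarith)
        _ = δ ^ (τ - τ / 2 * α) := by
            rw [← Real.rpow_mul hδ.1.le, ← Real.rpow_add hδ.1]
            congr 1
            ring
        _ ≤ 1 := Real.rpow_le_one hδ.1.le hδ.2.le (by nlinarith)

open Filter Topology in
theorem Generates.increment {κ α : ℝ} (h : Generates κ α) (hα0 : 0 < α) (hα : α < 2) :
    ∃ τ > 0, Generates κ (α + τ) := by
  set γ := 2 - α with hγ
  have hγ0 : 0 < γ := by rw [hγ]; linarith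
  have hγ2 : γ < 2 := by rw [hγ]; linarith
  set τ := α * γ / 200 with hτ
  have hτ0 : 0 < τ := by positivity
  obtain ⟨s, ε₀, hε₀, hev⟩ := h.all_scales hα0.le hα.le hτ0
  -- `ζ` is the exponent of the size bound on all elements that occur
  set ζ := τ / 100 with hζ
  have hζ0 : 0 < ζ := by positivity
  obtain ⟨ε, hε, hεε₀, hεζ⟩ : ∃ ε > 0, ε ≤ ε₀ ∧ ε * (2 : ℝ) ^ (s + 6) ≤ ζ := by
    refine ⟨min ε₀ (ζ / (2 : ℝ) ^ (s + 6)), by positivity, min_le_left _ _, ?_⟩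
    calc min ε₀ (ζ / (2 : ℝ) ^ (s + 6)) * (2 : ℝ) ^ (s + 6)
        ≤ (ζ / (2 : ℝ) ^ (s + 6)) * (2 : ℝ) ^ (s + 6) := by gcongr; exact min_le_right _ _
      _ = ζ := by field_simp
  have hεζ' : ε ≤ ζ := by
    refine le_trans ?_ hεζ
    exact le_mul_of_one_le_right hε.le (one_le_pow₀ (by norm_num))
  set w := 3 * γ / 100 with hw
  have hw0 : 0 < w := by positivity
  have hwα : w * α = 6 * τ := by rw [hw, hτ]; ring
  refine ⟨τ, hτ0, fun η hη => ⟨s + 6, ε, hε, ?_⟩⟩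
  have hταγ : τ * 100 ≤ γ := by rw [hτ]; nlinarith
  have hyα : γ / 4 * α = 50 * τ := by rw [hτ]; ring
  filter_upwards [eventually_Ioo_zero one_pos, hev ε hε hεε₀,
    eventually_mul_rpow_lt 2 hε one_pos,
    eventually_mul_rpow_lt ((20 : ℝ) ^ α) (show 0 < 2 * τ - 3 * ζ * α by nlinarith) one_pos,
    eventually_mul_rpow_lt 2 (show 0 < 1 - 2 * w by rw [hw]; linarith) one_pos,
    eventually_mul_rpow_lt (2 * (24 : ℝ) ^ α) (show 0 < 35 * τ - 2 * ζ * α by nlinarith) one_pos,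
    eventually_mul_rpow_lt (9216 : ℝ)
      (show 0 < γ / 2 - τ - 4 * w - 4 * ζ - 2 * ε by rw [hw]; linarith)
      (show (0 : ℝ) < 1 / 2 by norm_num)] with δ hδ hlow hM hH1 hsm hH2 hH3 A hA
  obtain ⟨hδ0, hδ1⟩ := hδ
  by_contra hcon
  obtain ⟨a, ha, haim⟩ := hA.exists_im
  have hmono : ∀ {x y : ℝ}, y ≤ x → δ ^ x ≤ δ ^ y := fun hxy =>
    Real.rpow_le_rpow_of_exponent_ge hδ0 hδ1.le hxy
  have hle1 : ∀ {x : ℝ}, 0 ≤ x → δ ^ x ≤ 1 := fun hx => Real.rpow_le_one hδ0.le hδ1.le hx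
  have hpos : ∀ x : ℝ, 0 < δ ^ x := fun x => Real.rpow_pos_of_pos hδ0 x
  have hR1 : 1 ≤ δ ^ (-ζ) := Real.one_le_rpow_of_pos_of_le_one_of_nonpos hδ0 hδ1.le (by linarith)
  have hup : ∀ P : Finset ℂ, (P : Set ℂ) ⊆ ringGen A (s + 6) → Separated δ P →
      (P.card : ℝ) ≤ δ ^ (-α - τ) := by
    intro P hP hPs
    by_contra hlt
    push Not at hlt
    exact hcon ⟨P, hP, hPs, (hmono (by linarith)).trans hlt.le⟩
  have hbd : ∀ x ∈ ringGen A (s + 6), ‖x‖ ≤ δ ^ (-ζ) := by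
    intro x hx
    have hM2 : 2 ≤ δ ^ (-ε) := by
      rw [Real.rpow_neg hδ0.le, ← one_div, le_div_iff₀ (hpos _)]
      exact hM.le
    refine (norm_le_of_mem_ringGen hM2 hA.norm_le _ x hx).trans ?_
    rw [← Real.rpow_natCast, ← Real.rpow_mul hδ0.le]
    apply hmono
    push_cast
    linarith
  have hw1 : w ≤ 1 := by rw [hw]; linarith
  have hρ₀ : δ ^ (-ζ) * δ / (δ ^ w) ^ 2 = δ ^ (1 - ζ - 2 * w) := by
    rw [← Real.rpow_natCast, ← Real.rpow_mul hδ0.le, div_eq_mul_inv, ← Real.rpow_neg hδ0.le]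
    nth_rewrite 2 [← Real.rpow_one δ]
    rw [← Real.rpow_add hδ0, ← Real.rpow_add hδ0]
    congr 1
    push_cast
    ring
  have hρ : 12 * δ ^ (-ζ) * (δ ^ (-ζ) * δ / (δ ^ w) ^ 2) = 12 * δ ^ (1 - 2 * ζ - 2 * w) := by
    rw [hρ₀, mul_assoc, ← Real.rpow_add hδ0]
    congr 2
    ring
  refine false_of_packing_le (R := δ ^ (-ζ)) (d := δ ^ w) (θ := δ ^ (γ / 4)) (β := δ ^ ε)
    (c := δ ^ τ) hδ0 ?_ (hle1 hw0.le) hR1 (hpos _) (hlow A hA) hup hbd ?_ ?_ ha (hpos _)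
    (hle1 hε.le) haim ?_ (hle1 (by positivity)) hρ.symm ?_ ?_
  · simpa using hmono hw1
  · have e1 : 4 * (δ ^ (-ζ)) ^ 2 * (1 + 4 * δ ^ (-ζ)) * (δ * δ ^ w) ≤
        20 * δ ^ (1 + w - 3 * ζ) := by
      have e2 : δ ^ (1 + w - 3 * ζ) = (δ ^ (-ζ)) ^ 3 * (δ * δ ^ w) := by
        rw [← Real.rpow_natCast, ← Real.rpow_mul hδ0.le, ← Real.rpow_one_add' hδ0.le (by linarith),
          ← Real.rpow_add hδ0]
        congr 1
        push_cast
        ring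
      rw [e2]
      have := mul_pos hδ0 (hpos w)
      have e3 : 4 * (δ ^ (-ζ)) ^ 2 * (1 + 4 * δ ^ (-ζ)) ≤ 20 * (δ ^ (-ζ)) ^ 3 := by
        nlinarith [sq_nonneg (δ ^ (-ζ))]
      calc _ ≤ 20 * (δ ^ (-ζ)) ^ 3 * (δ * δ ^ w) := by gcongr
        _ = _ := by ring
    have e4 : (20 * δ ^ (1 + w - 3 * ζ)) ^ (-α) ≤
        (4 * (δ ^ (-ζ)) ^ 2 * (1 + 4 * δ ^ (-ζ)) * (δ * δ ^ w)) ^ (-α) :=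
      Real.rpow_le_rpow_of_nonpos (by positivity) e1 (by linarith)
    refine lt_of_lt_of_le ?_ (mul_le_mul_of_nonneg_left e4 (by positivity))
    rw [Real.mul_rpow (by norm_num) (hpos _).le, ← Real.rpow_mul hδ0.le, ← Real.rpow_natCast,
      ← Real.rpow_mul hδ0.le, Real.rpow_neg (by norm_num)]
    have e5 : δ ^ (τ * (3 : ℕ)) * (((20 : ℝ) ^ α)⁻¹ * δ ^ ((1 + w - 3 * ζ) * -α)) =
        δ ^ (τ * (3 : ℕ) + (1 + w - 3 * ζ) * -α) / (20 : ℝ) ^ α := by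
      rw [Real.rpow_add hδ0]
      field_simp
    rw [e5, lt_div_iff₀ (by positivity)]
    calc δ ^ (-α - τ) * 20 ^ α
        = δ ^ (τ * (3 : ℕ) + (1 + w - 3 * ζ) * -α) * (20 ^ α * δ ^ (2 * τ - 3 * ζ * α)) := by
          rw [mul_comm ((20 : ℝ) ^ α), ← mul_assoc, ← Real.rpow_add hδ0]
          congr 2
          push_cast
          linear_combination -hwα
      _ < _ := mul_lt_of_lt_one_right (hpos _) hH1
  · rw [hρ₀, le_div_iff₀ (by norm_num)]
    calc δ ^ (1 - ζ - 2 * w) * 2 = δ ^ (-ζ) * (2 * δ ^ (1 - 2 * w)) := by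
          rw [show 1 - ζ - 2 * w = -ζ + (1 - 2 * w) by ring, Real.rpow_add hδ0]
          ring
      _ ≤ δ ^ (-ζ) := mul_le_of_le_one_right (hpos _).le hsm.le
  · simpa using hmono (show γ / 4 ≤ 1 by linarith)
  · rw [show 2 * (12 * δ ^ (1 - 2 * ζ - 2 * w)) * δ ^ (γ / 4) =
      24 * δ ^ (1 - 2 * ζ - 2 * w + γ / 4) by rw [Real.rpow_add hδ0]; ring,
      Real.mul_rpow (by norm_num) (hpos _).le, ← Real.rpow_mul hδ0.le, ← Real.rpow_natCast,
      ← Real.rpow_mul hδ0.le, Real.rpow_neg (by norm_num)]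
    have e5 : δ ^ (τ * (2 : ℕ)) * (((24 : ℝ) ^ α)⁻¹ * δ ^ ((1 - 2 * ζ - 2 * w + γ / 4) * -α)) =
        δ ^ (τ * (2 : ℕ) + (1 - 2 * ζ - 2 * w + γ / 4) * -α) / (24 : ℝ) ^ α := by
      rw [Real.rpow_add hδ0]
      field_simp
    rw [e5, le_div_iff₀ (by positivity)]
    calc 2 * δ ^ (-α - τ) * 24 ^ α
        = δ ^ (τ * (2 : ℕ) + (1 - 2 * ζ - 2 * w + γ / 4) * -α) *
            (2 * 24 ^ α * δ ^ (35 * τ - 2 * ζ * α)) := by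
          rw [mul_comm (2 * (24 : ℝ) ^ α), ← mul_assoc, ← Real.rpow_add hδ0,
            show τ * (2 : ℕ) + (1 - 2 * ζ - 2 * w + γ / 4) * -α + (35 * τ - 2 * ζ * α) =
              -α - τ by push_cast; linear_combination 2 * hwα - hyα]
          ring
      _ ≤ _ := mul_le_of_le_one_right (hpos _).le hH2.le
  · have e1 : 8 * (12 * δ ^ (1 - 2 * ζ - 2 * w)) / (δ ^ (γ / 4) * δ ^ ε) =
        96 * δ ^ (1 - 2 * ζ - 2 * w - γ / 4 - ε) := by
      have e0 : δ ^ (1 - 2 * ζ - 2 * w) =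
          δ ^ (1 - 2 * ζ - 2 * w - γ / 4 - ε) * (δ ^ (γ / 4) * δ ^ ε) := by
        rw [← Real.rpow_add hδ0, ← Real.rpow_add hδ0]
        congr 1
        ring
      rw [div_eq_iff (mul_pos (hpos _) (hpos _)).ne', e0]
      ring
    rw [e1, mul_pow, ← Real.rpow_natCast (δ ^ _), ← Real.rpow_mul hδ0.le]
    refine lt_of_eq_of_lt ?_ hH3
    rw [mul_left_comm, ← Real.rpow_add hδ0]
    congr 1
    · norm_num
    · congr 1
      push_cast
      rw [hγ]
      ring

/-- Bounded sums of products of ample sets are nearly two-dimensional. -/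
theorem generates_two {κ : ℝ} (hκ : 0 < κ) : Generates κ 2 := by
  have hanti : ∀ {α β : ℝ}, α ≤ β → Generates κ β → Generates κ α := by
    intro α β hαβ h η hη
    obtain ⟨s, ε, hε, hev⟩ := h η hη
    refine ⟨s, ε, hε, ?_⟩
    filter_upwards [hev, eventually_Ioo_zero one_pos] with δ h hδ A hA
    exact (h A hA).mono (Real.rpow_le_rpow_of_exponent_ge hδ.1 hδ.2.le (by linarith))
  by_contra hnot
  set T := {α : ℝ | Generates κ α} with hT
  have hbdd : BddAbove T := ⟨2, fun α hα => by
    by_contra hlt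
    exact hnot (hanti (not_le.1 hlt).le hα)⟩
  have hκT : κ ∈ T := generates_base
  have hsup : Generates κ (sSup T) := by
    intro η hη
    obtain ⟨α, hα, hlt⟩ := exists_lt_of_lt_csSup ⟨κ, hκT⟩ (sub_lt_self (sSup T) (half_pos hη))
    obtain ⟨s, ε, hε, hev⟩ := (show Generates κ α from hα) (η / 2) (half_pos hη)
    refine ⟨s, ε, hε, ?_⟩
    filter_upwards [hev, eventually_Ioo_zero one_pos] with δ h hδ A hA
    exact (h A hA).mono (Real.rpow_le_rpow_of_exponent_ge hδ.1 hδ.2.le (by linarith))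
  have hpos : 0 < sSup T := hκ.trans_le (le_csSup hbdd hκT)
  have hlt : sSup T < 2 := by
    by_contra hge
    exact hnot (hanti (not_lt.1 hge) hsup)
  obtain ⟨τ, hτ, hgen⟩ := hsup.increment hpos hlt
  linarith [le_csSup hbdd (show sSup T + τ ∈ T from hgen)]

/-! ### Covering by translates of sums of differences -/

/-- Sums of `n` differences of elements of `P`. -/
def diffSum (P : Finset ℂ) : ℕ → Finset ℂ
  | 0 => {0}
  | n + 1 => diffSum P n + (P - P)

section diffSum

variable {P : Finset ℂ} {m n : ℕ} {x y : ℂ}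

theorem add_mem_diffSum (hx : x ∈ diffSum P m) (hy : y ∈ diffSum P n) :
    x + y ∈ diffSum P (m + n) := by
  induction n generalizing y with
  | zero =>
    rw [diffSum, Finset.mem_singleton] at hy
    rw [hy, add_zero x]
    exact hx
  | succ n ih =>
    rw [diffSum, Finset.mem_add] at hy
    obtain ⟨y₁, hy₁, y₂, hy₂, rfl⟩ := hy
    rw [← add_assoc x]
    exact Finset.add_mem_add (ih hy₁) hy₂

theorem neg_mem_diffSum (hx : x ∈ diffSum P n) : -x ∈ diffSum P n := by
  induction n generalizing x with
  | zero =>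
    rw [diffSum, Finset.mem_singleton] at hx ⊢
    rw [hx, neg_zero]
  | succ n ih =>
    rw [diffSum, Finset.mem_add] at hx
    obtain ⟨y₁, hy₁, y₂, hy₂, rfl⟩ := hx
    obtain ⟨p, hp, q, hq, rfl⟩ := Finset.mem_sub.1 hy₂
    rw [neg_add, neg_sub]
    exact Finset.add_mem_add (ih hy₁) (Finset.sub_mem_sub hq hp)

theorem sub_mem_diffSum_one (hx : x ∈ P) (hy : y ∈ P) : x - y ∈ diffSum P 1 := by
  rw [← zero_add (x - y)]
  exact Finset.add_mem_add (Finset.mem_singleton_self 0) (Finset.sub_mem_sub hx hy)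

theorem zero_mem_diffSum (hP : P.Nonempty) (n : ℕ) : (0 : ℂ) ∈ diffSum P n := by
  obtain ⟨p, hp⟩ := hP
  induction n with
  | zero => exact Finset.mem_singleton_self 0
  | succ n ih =>
    rw [← add_zero (0 : ℂ)]
    refine Finset.add_mem_add ih ?_
    rw [← sub_self p]
    exact Finset.sub_mem_sub hp hp

theorem diffSum_mono (hP : P.Nonempty) (hmn : m ≤ n) : diffSum P m ⊆ diffSum P n := by
  intro x hx
  obtain ⟨k, rfl⟩ := Nat.exists_eq_add_of_le hmn
  rw [← add_zero x]
  exact add_mem_diffSum hx (zero_mem_diffSum hP k)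

theorem card_diffSum_le {K : ℝ} (hP : P.Nonempty) (hK : ((P + P).card : ℝ) ≤ K * P.card)
    (n : ℕ) : ((diffSum P n).card : ℝ) ≤ K ^ (2 * n) * P.card := by
  let _ : SMul ℕ (Finset ℂ) := Finset.nsmul
  have hsub : diffSum P n = n • P - n • P := by
    induction n with
    | zero =>
      rw [show 0 • P = {0} from zero_nsmul P, Finset.singleton_sub_singleton, sub_zero, diffSum]
    | succ n ih =>
      rw [diffSum, ih, show (n + 1) • P = n • P + P from succ_nsmul P n]
      exact (add_sub_add_comm _ _ _ _).symm
  have h := (NNRat.cast_le (K := ℝ)).2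
    (Finset.pluennecke_ruzsa_inequality_nsmul_sub_nsmul_add hP P n n)
  push_cast at h
  have h' : ((diffSum P n).card : ℝ) ≤ ((P + P).card / P.card : ℝ) ^ (n + n) * P.card := by
    rw [hsub]
    exact h
  have hc : (0 : ℝ) < P.card := by exact_mod_cast hP.card_pos
  refine h'.trans ?_
  rw [← two_mul]
  gcongr
  rwa [div_le_iff₀ hc]

end diffSum

/-- `S` lies within `L * δ` of a union of at most `L` translates of `diffSum P m`. -/
def CoveredBy (δ : ℝ) (P : Finset ℂ) (S : Set ℂ) (m : ℕ) (L : ℝ) : Prop :=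
  ∃ F : Finset ℂ, (F.card : ℝ) ≤ L ∧
    ∀ x ∈ S, ∃ f ∈ F, ∃ u ∈ diffSum P m, ‖x - f - u‖ ≤ L * δ

/-- The dilate of a finite set. -/
def dilate (b : ℂ) (P : Finset ℂ) : Set ℂ := {z | ∃ x ∈ P, z = b * x}

section CoveredBy

variable {δ : ℝ} {P : Finset ℂ} {S T U : Set ℂ} {m n : ℕ} {L M : ℝ}

theorem CoveredBy.mono (h : CoveredBy δ P S m L) (hδ : 0 ≤ δ) (hP : P.Nonempty) (hmn : m ≤ n)
    (hLM : L ≤ M) : CoveredBy δ P S n M := by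
  obtain ⟨F, hF, hc⟩ := h
  refine ⟨F, hF.trans hLM, fun x hx => ?_⟩
  obtain ⟨f, hf, u, hu, hxu⟩ := hc x hx
  exact ⟨f, hf, u, diffSum_mono hP hmn hu, hxu.trans (mul_le_mul_of_nonneg_right hLM hδ)⟩

theorem add_le_mul_of_two_le (hL : 2 ≤ L) (hM : 2 ≤ M) : L + M ≤ L * M := by
  nlinarith

theorem CoveredBy.add (hS : CoveredBy δ P S m L) (hT : CoveredBy δ P T n M) (hδ : 0 ≤ δ)
    (hL : 2 ≤ L) (hM : 2 ≤ M) (hU : ∀ z ∈ U, ∃ x ∈ S, ∃ y ∈ T, z = x + y) :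
    CoveredBy δ P U (m + n) (L * M) := by
  classical
  obtain ⟨F, hF, hc⟩ := hS
  obtain ⟨G, hG, hd⟩ := hT
  refine ⟨F + G, ?_, fun z hz => ?_⟩
  · calc ((F + G).card : ℝ) ≤ F.card * G.card := by exact_mod_cast Finset.card_add_le (α := ℂ)
      _ ≤ L * M := by gcongr
  · obtain ⟨x, hx, y, hy, rfl⟩ := hU z hz
    obtain ⟨f, hf, u, hu, hxu⟩ := hc x hx
    obtain ⟨g, hg, v, hv, hyv⟩ := hd y hy
    refine ⟨f + g, Finset.add_mem_add hf hg, u + v, add_mem_diffSum hu hv, ?_⟩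
    calc ‖x + y - (f + g) - (u + v)‖ = ‖(x - f - u) + (y - g - v)‖ := by
          congr 1
          ring
      _ ≤ L * δ + M * δ := (norm_add_le _ _).trans (add_le_add hxu hyv)
      _ = (L + M) * δ := by ring
      _ ≤ L * M * δ := mul_le_mul_of_nonneg_right (add_le_mul_of_two_le hL hM) hδ

theorem CoveredBy.neg (h : CoveredBy δ P S m L) (hT : ∀ z ∈ T, -z ∈ S) :
    CoveredBy δ P T m L := by
  classical
  obtain ⟨F, hF, hc⟩ := h
  refine ⟨-F, by rwa [Finset.card_neg], fun z hz => ?_⟩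
  obtain ⟨f, hf, u, hu, hxu⟩ := hc (-z) (hT z hz)
  refine ⟨-f, Finset.neg_mem_neg hf, -u, neg_mem_diffSum hu, ?_⟩
  rw [← norm_neg]
  refine le_of_eq_of_le (congrArg norm ?_) hxu
  ring

theorem CoveredBy.dilate_add {b c : ℂ} (hb : CoveredBy δ P (dilate b P) m L)
    (hc : CoveredBy δ P (dilate c P) n M) (hδ : 0 ≤ δ) (hL : 2 ≤ L) (hM : 2 ≤ M) :
    CoveredBy δ P (dilate (b + c) P) (m + n) (L * M) := by
  refine hb.add hc hδ hL hM ?_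
  rintro z ⟨x, hx, rfl⟩
  exact ⟨b * x, ⟨x, hx, rfl⟩, c * x, ⟨x, hx, rfl⟩, add_mul b c x⟩

theorem CoveredBy.dilate_neg {c : ℂ} (hc : CoveredBy δ P (dilate c P) n M) :
    CoveredBy δ P (dilate (-c) P) n M := by
  refine hc.neg ?_
  rintro z ⟨x, hx, rfl⟩
  exact ⟨x, hx, by ring⟩

theorem CoveredBy.dilate_diffSum {b : ℂ} (hb : CoveredBy δ P (dilate b P) m L) (hδ : 0 ≤ δ)
    (hL : 2 ≤ L) (n : ℕ) :
    CoveredBy δ P (dilate b (diffSum P n)) (2 * m * n) (L ^ (2 * n + 1)) := by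
  induction n with
  | zero =>
    refine ⟨{0}, by simp; linarith, ?_⟩
    rintro z ⟨x, hx, rfl⟩
    rw [diffSum, Finset.mem_singleton] at hx
    refine ⟨0, Finset.mem_singleton_self 0, 0, Finset.mem_singleton_self 0, ?_⟩
    rw [hx]
    simp only [mul_zero, sub_zero, norm_zero]
    positivity
  | succ n ih =>
    have hpow : ∀ k : ℕ, 2 ≤ L ^ (k + 1) := fun k =>
      hL.trans (le_self_pow₀ (by linarith) k.succ_ne_zero)
    have hdiff : CoveredBy δ P {z | ∃ x ∈ P, ∃ y ∈ P, z = b * x - b * y} (m + m) (L * L) := by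
      refine hb.add hb.dilate_neg hδ hL hL ?_
      rintro z ⟨x, hx, y, hy, rfl⟩
      exact ⟨b * x, ⟨x, hx, rfl⟩, -b * y, ⟨y, hy, rfl⟩, by ring⟩
    have h := ih.add hdiff hδ (hpow _) (by nlinarith)
      (U := dilate b (diffSum P (n + 1))) ?_
    · convert h using 1 <;> ring
    · rintro z ⟨x, hx, rfl⟩
      rw [diffSum, Finset.mem_add] at hx
      obtain ⟨y, hy, w, hw, rfl⟩ := hx
      obtain ⟨p, hp, q, hq, rfl⟩ := Finset.mem_sub.1 hw
      exact ⟨b * y, ⟨y, hy, rfl⟩, b * p - b * q, ⟨p, hp, q, hq, rfl⟩, by ring⟩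

theorem CoveredBy.dilate_mul {b c : ℂ} {R : ℝ} (hb : CoveredBy δ P (dilate b P) m L)
    (hc : CoveredBy δ P (dilate c P) n M) (hδ : 0 ≤ δ) (hL : 2 ≤ L) (hM : 2 ≤ M) (hR : 2 ≤ R)
    (hbR : ‖b‖ ≤ R) :
    CoveredBy δ P (dilate (b * c) P) (2 * m * n) (R * M * L ^ (2 * n + 1)) := by
  classical
  obtain ⟨F, hF, hFc⟩ := hc
  obtain ⟨G, hG, hGc⟩ := hb.dilate_diffSum hδ hL n
  have hpow : 2 ≤ L ^ (2 * n + 1) := hL.trans (le_self_pow₀ (by linarith) (2 * n).succ_ne_zero)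
  refine ⟨F.image (fun x : ℂ => b * x) + G, ?_, ?_⟩
  · calc ((F.image (fun x : ℂ => b * x) + G).card : ℝ) ≤ (F.image (fun x : ℂ => b * x)).card * G.card := by
          exact_mod_cast Finset.card_add_le (α := ℂ)
      _ ≤ F.card * G.card := by
          exact mul_le_mul_of_nonneg_right (Nat.cast_le.2 Finset.card_image_le) (Nat.cast_nonneg _)
      _ ≤ M * L ^ (2 * n + 1) := by gcongr
      _ ≤ R * M * L ^ (2 * n + 1) := by
          gcongr
          exact le_mul_of_one_le_left (by linarith) (by linarith)
  · rintro z ⟨x, hx, rfl⟩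
    obtain ⟨f, hf, u, hu, hxu⟩ := hFc (c * x) ⟨x, hx, rfl⟩
    obtain ⟨g, hg, v, hv, hyv⟩ := hGc (b * u) ⟨u, hu, rfl⟩
    refine ⟨b * f + g, Finset.add_mem_add (Finset.mem_image_of_mem _ hf) hg, v, hv, ?_⟩
    calc ‖b * c * x - (b * f + g) - v‖ = ‖b * (c * x - f - u) + (b * u - g - v)‖ := by
          congr 1
          ring
      _ ≤ R * (M * δ) + L ^ (2 * n + 1) * δ := by
          refine (norm_add_le _ _).trans (add_le_add ?_ hyv)
          rw [norm_mul]
          gcongr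
      _ = (R * M + L ^ (2 * n + 1)) * δ := by ring
      _ ≤ R * M * L ^ (2 * n + 1) * δ :=
          mul_le_mul_of_nonneg_right (add_le_mul_of_two_le (by nlinarith) hpow) hδ

theorem coveredBy_dilate_one (hδ : 0 ≤ δ) (hP : P.Nonempty) (hL : 1 ≤ L) :
    CoveredBy δ P (dilate 1 P) 1 L := by
  obtain ⟨p, hp⟩ := hP
  refine ⟨{p}, by simpa using hL, ?_⟩
  rintro z ⟨x, hx, rfl⟩
  refine ⟨p, Finset.mem_singleton_self p, x - p, sub_mem_diffSum_one hx hp, ?_⟩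
  rw [one_mul, sub_self, norm_zero]
  positivity

/-- Coverings of dilates by elements of `A` propagate to the elements generated by `A`. -/
theorem exists_coveredBy_ringGen (n : ℕ) : ∃ m C : ℕ, 1 ≤ C ∧
    ∀ (δ : ℝ) (P : Finset ℂ) (A : Set ℂ) (L : ℝ), 0 ≤ δ → P.Nonempty → 2 ≤ L →
      (∀ a ∈ A, ‖a‖ ≤ L) → (∀ a ∈ A, CoveredBy δ P (dilate a P) 1 L) →
      ∀ b ∈ ringGen A n, CoveredBy δ P (dilate b P) m (L ^ C) := by
  induction n with
  | zero =>
    refine ⟨1, 1, le_rfl, fun δ P A L hδ hP hL _ hA b hb => ?_⟩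
    rw [pow_one]
    rcases hb with rfl | hb
    · exact coveredBy_dilate_one hδ hP (by linarith)
    · exact hA b hb
  | succ n ih =>
    obtain ⟨m, C, hC, h⟩ := ih
    refine ⟨2 * m + 2 * m * m, 2 ^ n + C + C * (2 * m + 1), by
      have := Nat.zero_le (C * (2 * m + 1))
      have := Nat.zero_le (2 ^ n)
      lia,
      fun δ P A L hδ hP hL hnorm hA b hb => ?_⟩
    have hcov := h δ P A L hδ hP hL hnorm hA
    have hL1 : 1 ≤ L := by linarith
    have hLC : 2 ≤ L ^ C := hL.trans (le_self_pow₀ hL1 (by omega))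
    have hLn : 2 ≤ L ^ 2 ^ n := hL.trans (le_self_pow₀ hL1 (by positivity))
    have h2C : L ^ C * L ^ C ≤ L ^ (2 ^ n + C + C * (2 * m + 1)) := by
      rw [← pow_add]
      exact pow_le_pow_right₀ hL1 (by
        have := Nat.zero_le (C * m)
        have := Nat.zero_le (2 ^ n)
        rw [show C * (2 * m + 1) = 2 * (C * m) + C by ring]
        lia)
    rcases hb with hb | ⟨x, hx, y, hy, rfl | rfl | rfl⟩
    · exact (hcov b hb).mono hδ hP (by nlinarith) (pow_le_pow_right₀ hL1 (by
        rw [add_right_comm]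
        exact Nat.le_add_left _ _))
    · exact ((hcov x hx).dilate_add (hcov y hy) hδ hLC hLC).mono hδ hP (by nlinarith) h2C
    · rw [sub_eq_add_neg]
      exact ((hcov x hx).dilate_add (hcov y hy).dilate_neg hδ hLC hLC).mono hδ hP
        (by nlinarith) h2C
    · refine ((hcov x hx).dilate_mul (hcov y hy) hδ hLC hLC hLn
        (norm_le_of_mem_ringGen hL hnorm n x hx)).mono hδ hP (by nlinarith) ?_
      rw [← pow_mul, ← pow_add, ← pow_add]

/-- Ruzsa's covering lemma at scale `ρ`. -/
theorem coveredBy_dilate_of_card_le {ρ L : ℝ} {a : ℂ} (hρ : 0 < ρ) (hδ : ρ ≤ L * δ)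
    (hP : P.Nonempty) (hPsep : Separated ρ P)
    (hU : ∀ Q : Finset ℂ, (∀ z ∈ Q, ∃ x ∈ P, ∃ y ∈ P, z = x + a * y) → Separated ρ Q →
      (Q.card : ℝ) ≤ L * P.card) :
    CoveredBy δ P (dilate a P) 1 L := by
  classical
  let good : Finset ℂ → Prop := fun F => F ⊆ P.image (fun x : ℂ => a * x) ∧
    ∀ f ∈ F, ∀ g ∈ F, f ≠ g → ∀ x ∈ P, ∀ y ∈ P, ρ ≤ ‖(f + x) - (g + y)‖
  obtain ⟨F, ⟨hFP, hF⟩, hmax⟩ := exists_maximal_card good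
    ⟨by simp, fun f hf => by simp at hf⟩ (P.image (fun x : ℂ => a * x)).card
    (fun F hF => Finset.card_le_card hF.1)
  have hc : (0 : ℝ) < P.card := by exact_mod_cast hP.card_pos
  refine ⟨F, ?_, ?_⟩
  · obtain ⟨hsep, hcard⟩ := separated_image hρ (F ×ˢ P) (fun i => i.1 + i.2) (by
      rintro ⟨f, x⟩ hi ⟨g, y⟩ hj hne
      obtain ⟨hf, hx⟩ := Finset.mem_product.1 hi
      obtain ⟨hg, hy⟩ := Finset.mem_product.1 hj
      rcases eq_or_ne f g with rfl | hfg
      · have hxy : x ≠ y := fun e => hne (by rw [e])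
        simpa using hPsep x hx y hy hxy
      · exact hF f hf g hg hfg x hx y hy)
    have h := hU _ (by
      intro z hz
      obtain ⟨⟨f, x⟩, hi, rfl⟩ := Finset.mem_image.1 hz
      obtain ⟨hf, hx⟩ := Finset.mem_product.1 hi
      obtain ⟨y, hy, rfl⟩ := Finset.mem_image.1 (hFP hf)
      exact ⟨x, hx, y, hy, add_comm _ _⟩) hsep
    rw [hcard, Finset.card_product, Nat.cast_mul] at h
    exact le_of_mul_le_mul_right h hc
  · rintro z ⟨x, hx, rfl⟩
    by_cases hmem : a * x ∈ F
    · refine ⟨a * x, hmem, 0, zero_mem_diffSum hP 1, ?_⟩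
      simpa using hρ.le.trans hδ
    by_contra hfar
    push Not at hfar
    have hnear : ∀ f ∈ F, ∀ p ∈ P, ∀ q ∈ P, ρ ≤ ‖(a * x + p) - (f + q)‖ := by
      intro f hf p hp q hq
      refine hδ.trans ((hfar f hf (q - p) (sub_mem_diffSum_one hq hp)).le.trans_eq ?_)
      congr 1
      ring
    have hgood : good (insert (a * x) F) := by
      refine ⟨Finset.insert_subset (Finset.mem_image_of_mem _ hx) hFP, ?_⟩
      intro f hf g hg hne p hp q hq
      rcases Finset.mem_insert.1 hf with rfl | hf <;> rcases Finset.mem_insert.1 hg with rfl | hg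
      · exact absurd rfl hne
      · exact hnear g hg p hp q hq
      · rw [norm_sub_rev]
        exact hnear f hf q hq p hp
      · exact hF f hf g hg hne p hp q hq
    have := hmax _ hgood
    rw [Finset.card_insert_of_notMem hmem] at this
    omega

/-- A covered dilate has small sum with the original set. -/
theorem CoveredBy.card_le {b : ℂ} {K : ℝ} (h : CoveredBy δ P (dilate b P) m L) (hδ : 0 < δ)
    (hL : 0 ≤ L) (hK : ((P + P).card : ℝ) ≤ K * P.card) {Q : Finset ℂ}
    (hQ : ∀ z ∈ Q, ∃ x ∈ P, ∃ y ∈ P, z = x + b * y) (hQsep : Separated (δ / 4) Q) :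
    (Q.card : ℝ) ≤ L * (K ^ (2 * (m + 1)) * P.card) * (1 + 8 * L) ^ 2 := by
  classical
  rcases P.eq_empty_or_nonempty with rfl | hP
  · have : Q = ∅ := Finset.eq_empty_of_forall_notMem fun z hz => by simpa using hQ z hz
    simp [this]
  obtain ⟨p, hp⟩ := id hP
  obtain ⟨F, hF, hc⟩ := h
  have h := hQsep.card_le_mul (by positivity) (r := L * δ) (by positivity)
    (F.image (fun x : ℂ => p + x) + diffSum P (m + 1)) (by
      intro z hz
      obtain ⟨x, hx, y, hy, rfl⟩ := hQ z hz
      obtain ⟨f, hf, u, hu, hyu⟩ := hc (b * y) ⟨y, hy, rfl⟩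
      refine ⟨(p + f) + (u + (x - p)), Finset.add_mem_add (Finset.mem_image_of_mem _ hf)
        (add_mem_diffSum hu (sub_mem_diffSum_one hx hp)), ?_⟩
      convert hyu using 2
      ring)
  have hcard : ((F.image (fun x : ℂ => p + x) + diffSum P (m + 1)).card : ℝ) ≤
      L * (K ^ (2 * (m + 1)) * P.card) := by
    calc ((F.image (fun x : ℂ => p + x) + diffSum P (m + 1)).card : ℝ)
        ≤ (F.image (fun x : ℂ => p + x)).card * (diffSum P (m + 1)).card := by
          exact_mod_cast Finset.card_add_le (α := ℂ)
      _ ≤ F.card * (diffSum P (m + 1)).card := by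
          exact mul_le_mul_of_nonneg_right (Nat.cast_le.2 Finset.card_image_le) (Nat.cast_nonneg _)
      _ ≤ _ := mul_le_mul hF (card_diffSum_le hP hK _) (by positivity) hL
  refine h.trans ?_
  rw [show 2 * (L * δ) / (δ / 4) = 8 * L by field_simp; ring]
  gcongr

end CoveredBy

/-! ### Rounding to a lattice -/

/-- A bounded set is close to a finite set whose sumset is separated. -/
theorem exists_rounding {δ r : ℝ} (hδ : 0 < δ) {X : Set ℂ} (hX : ∀ x ∈ X, ‖x‖ ≤ r) :
    ∃ P : Finset ℂ, (∀ p ∈ P, ∃ x ∈ X, ‖p - x‖ ≤ δ) ∧ (∀ x ∈ X, ∃ p ∈ P, ‖x - p‖ ≤ δ) ∧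
      Separated (δ / 2) P ∧ Separated (δ / 2) (P + P) := by
  classical
  set h := δ / 2 with hh
  have hh0 : 0 < h := by positivity
  let pt : ℤ × ℤ → ℂ := fun i => ⟨h * i.1, h * i.2⟩
  let rd : ℂ → ℤ × ℤ := fun z => (⌊z.re / h⌋, ⌊z.im / h⌋)
  have hfloor : ∀ t : ℝ, |t - h * ⌊t / h⌋| ≤ h := by
    intro t
    have h1 := Int.floor_le (t / h)
    have h2 := (Int.lt_floor_add_one (t / h)).le
    rw [le_div_iff₀ hh0] at h1
    rw [div_le_iff₀ hh0] at h2
    rw [abs_le]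
    constructor <;> nlinarith
  have hrd : ∀ z : ℂ, ‖z - pt (rd z)‖ ≤ δ := by
    intro z
    refine (Complex.norm_le_abs_re_add_abs_im _).trans ?_
    have h1 := hfloor z.re
    have h2 := hfloor z.im
    simp only [pt, rd, Complex.sub_re, Complex.sub_im]
    linarith
  have hsep : ∀ i j : ℤ × ℤ, pt i ≠ pt j → h ≤ ‖pt i - pt j‖ := by
    intro i j hne
    have hcases : i.1 ≠ j.1 ∨ i.2 ≠ j.2 := by
      by_contra hcon
      push Not at hcon
      exact hne (by rw [Prod.ext hcon.1 hcon.2])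
    have habs : ∀ u v : ℤ, u ≠ v → h ≤ |h * u - h * v| := by
      intro u v huv
      have h1 : (1 : ℝ) ≤ |(u : ℝ) - v| := by
        exact_mod_cast Int.one_le_abs (sub_ne_zero.2 huv)
      rw [← mul_sub, abs_mul, abs_of_pos hh0]
      exact le_mul_of_one_le_right hh0.le h1
    rcases hcases with hne | hne
    · exact (habs _ _ hne).trans (by simpa [pt] using Complex.abs_re_le_norm (pt i - pt j))
    · exact (habs _ _ hne).trans (by simpa [pt] using Complex.abs_im_le_norm (pt i - pt j))
  have hfin : (rd '' X).Finite := by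
    have hbound : ∀ t : ℝ, |t| ≤ r → ⌊t / h⌋ ∈ Icc ⌊-r / h⌋ ⌊r / h⌋ := by
      intro t ht
      rw [abs_le] at ht
      exact ⟨Int.floor_mono (by gcongr; exact ht.1), Int.floor_mono (by gcongr; exact ht.2)⟩
    refine ((finite_Icc ⌊-r / h⌋ ⌊r / h⌋).prod (finite_Icc ⌊-r / h⌋ ⌊r / h⌋)).subset ?_
    rintro _ ⟨z, hz, rfl⟩
    exact ⟨hbound _ ((Complex.abs_re_le_norm z).trans (hX z hz)),
      hbound _ ((Complex.abs_im_le_norm z).trans (hX z hz))⟩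
  refine ⟨hfin.toFinset.image pt, ?_, ?_, ?_, ?_⟩
  · intro p hp
    obtain ⟨i, hi, rfl⟩ := Finset.mem_image.1 hp
    obtain ⟨x, hx, rfl⟩ := hfin.mem_toFinset.1 hi
    exact ⟨x, hx, by rw [norm_sub_rev]; exact hrd x⟩
  · intro x hx
    exact ⟨pt (rd x), Finset.mem_image_of_mem _ (hfin.mem_toFinset.2 ⟨x, hx, rfl⟩), hrd x⟩
  · intro p hp q hq
    obtain ⟨i, hi, rfl⟩ := Finset.mem_image.1 hp
    obtain ⟨j, hj, rfl⟩ := Finset.mem_image.1 hq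
    exact hsep i j
  · intro p hp q hq
    have hlat : ∀ z ∈ hfin.toFinset.image pt + hfin.toFinset.image pt, ∃ i, z = pt i := by
      intro z hz
      obtain ⟨x, hx, y, hy, rfl⟩ := Finset.mem_add.1 hz
      obtain ⟨i, -, rfl⟩ := Finset.mem_image.1 hx
      obtain ⟨j, -, rfl⟩ := Finset.mem_image.1 hy
      refine ⟨i + j, Complex.ext ?_ ?_⟩ <;> simp [pt, mul_add]
    obtain ⟨i, rfl⟩ := hlat p hp
    obtain ⟨j, rfl⟩ := hlat q hq
    exact hsep i j

/-! ### Dilates by generated elements -/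

/-- If `P + a P` is small for all `a ∈ A` then `P + b P` is small for all elements `b` generated
by `A`. -/
theorem exists_card_add_dilate_le (s : ℕ) : ∃ D : ℕ,
    ∀ (δ : ℝ) (P : Finset ℂ) (A : Set ℂ) (L : ℝ), 0 < δ → P.Nonempty → 2 ≤ L →
      (∀ a ∈ A, ‖a‖ ≤ L) → Separated (δ / 2) P → ((P + P).card : ℝ) ≤ L * P.card →
      (∀ a ∈ A, ∀ Q : Finset ℂ, (∀ z ∈ Q, ∃ x ∈ P, ∃ y ∈ P, z = x + a * y) →
        Separated (δ / 2) Q → (Q.card : ℝ) ≤ L * P.card) →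
      ∀ b ∈ ringGen A s, ∀ Q : Finset ℂ, (∀ z ∈ Q, ∃ x ∈ P, ∃ y ∈ P, z = x + b * y) →
        Separated (δ / 4) Q → (Q.card : ℝ) ≤ L ^ D * P.card := by
  obtain ⟨m, C, -, h⟩ := exists_coveredBy_ringGen s
  refine ⟨C + 2 * (m + 1) + (7 + 2 * C), fun δ P A L hδ hP hL hnorm hsep hK hA b hb Q hQ hQs => ?_⟩
  have hcov := h δ P A L hδ.le hP hL hnorm (fun a ha =>
    coveredBy_dilate_of_card_le (half_pos hδ) (by nlinarith) hP hsep (hA a ha)) b hb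
  have h1 : 1 ≤ L ^ C := one_le_pow₀ (by linarith)
  have h2 : (1 + 8 * L ^ C) ^ 2 ≤ L ^ (7 + 2 * C) := by
    have h3 : (2 : ℝ) ^ 7 ≤ L ^ 7 := by gcongr
    have h4 : (1 + 8 * L ^ C) ^ 2 ≤ 2 ^ 7 * (L ^ C) ^ 2 := by nlinarith
    calc (1 + 8 * L ^ C) ^ 2 ≤ 2 ^ 7 * (L ^ C) ^ 2 := h4
      _ ≤ L ^ 7 * (L ^ C) ^ 2 := by gcongr
      _ = L ^ (7 + 2 * C) := by ring
  calc (Q.card : ℝ) ≤ L ^ C * (L ^ (2 * (m + 1)) * P.card) * (1 + 8 * L ^ C) ^ 2 :=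
        hcov.card_le hδ (by positivity) hK hQ hQs
    _ ≤ L ^ C * (L ^ (2 * (m + 1)) * P.card) * L ^ (7 + 2 * C) := by gcongr
    _ = L ^ (C + 2 * (m + 1) + (7 + 2 * C)) * P.card := by
        rw [pow_add _ (C + 2 * (m + 1)), pow_add L C]
        ring

/-- Small sums `P + b P` for all `b` in a large separated set force `P` to be large. -/
theorem false_of_dilates_small {δ ρ T : ℝ} {P Y B : Finset ℂ} (hδ : 0 < δ) (hρ : 0 < ρ)
    (hT : 0 < T) (hP : P.Nonempty) (hPs : Separated (δ / 2) P) (hYP : Y ⊆ P)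
    (hY : Separated ρ Y) (hB : Separated δ B)
    (hU : ∀ b ∈ B, ∀ Q : Finset ℂ, (∀ z ∈ Q, ∃ x ∈ P, ∃ y ∈ P, z = x + b * y) →
      Separated (δ / 4) Q → (Q.card : ℝ) ≤ T * P.card)
    (hYT : 2 * T < Y.card) (hBT : 2 * T * ((1 + 2 / ρ) ^ 2 * P.card) ≤ B.card) : False := by
  classical
  have hc : (0 : ℝ) < P.card := by exact_mod_cast hP.card_pos
  have h := card_mul_card_le_of_dilates (ρ := δ / 4) (U := T * P.card) (m := (1 + 2 / ρ) ^ 2)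
    (X := P) (Y := Y) (B := B) (by positivity) (by positivity) (by positivity)
    (by rwa [show 2 * (δ / 4) = δ / 2 by ring]) ?_ ?_
  · have hBpos : (0 : ℝ) < B.card := lt_of_lt_of_le (by positivity) hBT
    have h' : (B.card : ℝ) * Y.card * P.card ≤
        (T * B.card + T * ((1 + 2 / ρ) ^ 2 * P.card) * Y.card) * P.card := by
      calc (B.card : ℝ) * Y.card * P.card = B.card * (P.card * Y.card) := by ring
        _ ≤ _ := h
        _ = _ := by ring
    have h'' := le_of_mul_le_mul_right h' hc
    nlinarith [mul_le_mul_of_nonneg_right hBT (Nat.cast_nonneg (α := ℝ) Y.card),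
      mul_lt_mul_of_pos_right hYT hBpos]
  · intro y hy y' hy' hne z
    have hsub := hB.subset (Finset.filter_subset (fun b => ‖z + b * (y - y')‖ < 2 * (δ / 4)) B)
    rcases (B.filter fun b => ‖z + b * (y - y')‖ < 2 * (δ / 4)).eq_empty_or_nonempty with h0 | h0
    · rw [h0, Finset.card_empty, Nat.cast_zero]
      positivity
    obtain ⟨c, hcm⟩ := h0
    have hw := hY y hy y' hy' hne
    have hcc := (Finset.mem_filter.1 hcm).2
    refine (hsub.card_le hδ (c := c) (r := δ / ρ) (by positivity) fun b hb => ?_).trans_eq ?_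
    · have hbb := (Finset.mem_filter.1 hb).2
      rw [le_div_iff₀ hρ]
      calc ‖b - c‖ * ρ ≤ ‖b - c‖ * ‖y - y'‖ := by gcongr
        _ = ‖(z + b * (y - y')) - (z + c * (y - y'))‖ := by
            rw [← norm_mul]
            congr 1
            ring
        _ ≤ ‖z + b * (y - y')‖ + ‖z + c * (y - y')‖ := norm_sub_le _ _
        _ ≤ δ := by linarith
    · congr 2
      field_simp
  · intro b hb Q hQ hQs
    refine hU b hb Q (fun z hz => ?_) hQs
    obtain ⟨x, hx, y, hy, rfl⟩ := hQ z hz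
    exact ⟨x, hx, y, hYP hy, rfl⟩

/-- Discretized sum-product estimate in `ℂ`: given `κ > 0` and `σ ∈ (0,2)` there is
`ε > 0` such that for all sufficiently small `δ > 0`, if `A, X ⊆ B_ℂ(0, δ^{-ε})` satisfy
(i) `𝒩_ρ(A) ≥ δ^ε ρ^{-κ}` for all `ρ ≥ δ`, (ii) `A` is `δ^ε` away from `ℝ` (some
`a ∈ A` has `|Im a| ≥ δ^ε`), (iii) `𝒩_ρ(X) ≥ δ^ε ρ^{-κ}` for all `ρ ≥ δ`, and
(iv) `𝒩_δ(X) ≤ δ^{-(2-σ)-ε}`, then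
`𝒩_δ(X+X) + sup_{a∈A} 𝒩_δ(X+aX) ≥ δ^{-ε} 𝒩_δ(X)`. -/
theorem discretized_sum_product_complex (κ σ : ℝ) (hκ : 0 < κ) (hσ : σ ∈ Set.Ioo (0:ℝ) 2) :
    ∃ ε > (0:ℝ), ∃ δ₀ > (0:ℝ), ∀ δ : ℝ, 0 < δ → δ < δ₀ →
      ∀ A X : Set ℂ, A ⊆ closedBall (0 : ℂ) (δ ^ (-ε)) →
        X ⊆ closedBall (0 : ℂ) (δ ^ (-ε)) →
        (∀ ρ : ℝ, δ ≤ ρ → δ ^ ε * ρ ^ (-κ) ≤ (coverNum ρ A : ℝ)) →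
        (∃ a ∈ A, δ ^ ε ≤ |a.im|) →
        (∀ ρ : ℝ, δ ≤ ρ → δ ^ ε * ρ ^ (-κ) ≤ (coverNum ρ X : ℝ)) →
        (coverNum δ X : ℝ) ≤ δ ^ (-(2 - σ) - ε) →
        δ ^ (-ε) * (coverNum δ X : ℝ) ≤
          (coverNum δ (X + X) : ℝ) +
            ((sSup ((fun a => coverNum δ (X + a • X)) '' A) : ℕ) : ℝ) := by
  obtain ⟨hσ0, hσ2⟩ := hσ
  obtain ⟨s, ε₁, hε₁, hgen⟩ := generates_two hκ (σ / 4) (by positivity)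
  obtain ⟨D, hD⟩ := exists_card_add_dilate_le s
  set θ := min (σ / 4) (σ * κ / 16) with hθ
  have hθ0 : 0 < θ := lt_min (by positivity) (by positivity)
  set ε := min ε₁ (θ / (1 + 4 * D)) with hε
  have hε0 : 0 < ε := lt_min hε₁ (by positivity)
  have hεθ : ε + 4 * D * ε ≤ θ := by
    have h1 : ε ≤ θ / (1 + 4 * D) := min_le_right _ _
    rw [le_div_iff₀ (by positivity)] at h1
    linarith
  have hθσ : θ ≤ σ / 4 := min_le_left _ _
  have hθκ : θ ≤ σ * κ / 16 := min_le_right _ _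
  have hev := ((((hgen.and (eventually_Ioo_zero one_pos)).and
    (eventually_mul_rpow_lt 169 hε0 one_pos)).and
    (eventually_mul_rpow_lt (2 * 2 ^ κ) (show 0 < σ * κ / 16 by positivity) one_pos)).and
    (eventually_mul_rpow_lt 1458 (show 0 < σ / 4 by positivity) one_pos))
  obtain ⟨δ₀, hδ₀, hsub⟩ := mem_nhdsGT_iff_exists_Ioo_subset.1 hev
  refine ⟨ε, hε0, δ₀, hδ₀, fun δ hδ hδlt A X hAb hXb hA hAim hX hXle => ?_⟩
  obtain ⟨⟨⟨⟨hgenδ, -, hδ1⟩, h169⟩, hYδ⟩, hBδ⟩ := hsub ⟨hδ, hδlt⟩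
  by_contra hcon
  rw [not_le] at hcon
  have hpos : ∀ x : ℝ, 0 < δ ^ x := Real.rpow_pos_of_pos hδ
  set r := δ ^ (-ε) with hr
  have hr0 : 0 < r := hpos _
  have hr1 : 1 ≤ r := Real.one_le_rpow_of_pos_of_le_one_of_nonpos hδ hδ1.le (by linarith)
  have hrε : r * δ ^ ε = 1 := by
    rw [hr, ← Real.rpow_add hδ, neg_add_cancel, Real.rpow_zero]
  have hrbig : 169 ≤ r := by
    nlinarith
  have hAn : ∀ a ∈ A, ‖a‖ ≤ r := fun a ha => by simpa using hAb ha
  have hXn : ∀ x ∈ X, ‖x‖ ≤ r := fun x hx => by simpa using hXb hx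
  have hXXn : ∀ z ∈ X + X, ‖z‖ ≤ r + r := by
    intro z hz
    obtain ⟨x, hx, y, hy, rfl⟩ := Set.mem_add.1 hz
    exact (norm_add_le _ _).trans (add_le_add (hXn x hx) (hXn y hy))
  have hXaXn : ∀ a ∈ A, ∀ z ∈ X + a • X, ‖z‖ ≤ r + r * r := by
    intro a ha z hz
    obtain ⟨x, hx, w, hw, rfl⟩ := Set.mem_add.1 hz
    obtain ⟨y, hy, rfl⟩ := Set.mem_smul_set.1 hw
    refine (norm_add_le _ _).trans (add_le_add (hXn x hx) ?_)
    rw [norm_smul]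
    exact mul_le_mul (hAn a ha) (hXn y hy) (norm_nonneg _) hr0.le
  set N : ℝ := (coverNum δ X : ℝ) with hN
  have hXX : (coverNum δ (X + X) : ℝ) ≤ r * N :=
    le_of_lt (lt_of_le_of_lt (le_add_of_nonneg_right (Nat.cast_nonneg _)) hcon)
  have hXaX : ∀ a ∈ A, (coverNum δ (X + a • X) : ℝ) ≤ r * N := by
    intro a ha
    have hbdd : BddAbove ((fun a => coverNum δ (X + a • X)) '' A) := by
      refine ⟨⌊(1 + 2 * (r + r * r) / δ) ^ 2⌋₊, ?_⟩
      rintro _ ⟨b, hb, rfl⟩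
      exact Nat.le_floor (coverNum_le_of_norm_le hδ (by positivity) (hXaXn b hb))
    have h1 : coverNum δ (X + a • X) ≤ sSup ((fun a => coverNum δ (X + a • X)) '' A) :=
      le_csSup hbdd ⟨a, ha, rfl⟩
    have h1' : (coverNum δ (X + a • X) : ℝ) ≤
        ((sSup ((fun a => coverNum δ (X + a • X)) '' A) : ℕ) : ℝ) := Nat.cast_le.2 h1
    linarith [Nat.cast_nonneg (α := ℝ) (coverNum δ (X + X))]
  obtain ⟨P, hPX, hXP, hPs, hPPs⟩ := exists_rounding hδ hXn
  have hNP : N ≤ P.card := Nat.cast_le.2 (coverNum_le_card P hXP)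
  have hN0 : 0 < N := lt_of_lt_of_le (mul_pos (hpos _) (hpos _)) (hX δ le_rfl)
  have hPc : (0 : ℝ) < P.card := hN0.trans_le hNP
  have hPne : P.Nonempty := Finset.card_pos.1 (by exact_mod_cast hPc)
  have hP81 : (P.card : ℝ) ≤ 81 * N := by
    refine (hPs.card_le_coverNum (half_pos hδ) hδ hδ.le hXn hPX).trans_eq ?_
    rw [show 1 + 2 * (δ + δ) / (δ / 2) = 9 by field_simp; norm_num]
    ring
  have hr4 : δ ^ (-(4 * ε)) = r ^ 4 := by
    rw [hr, ← Real.rpow_natCast (δ ^ (-ε)), ← Real.rpow_mul hδ.le]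
    congr 1
    push_cast
    ring
  set L := r ^ 4 with hL
  have hrL : r ≤ L := le_self_pow₀ hr1 (by norm_num)
  have hL2 : 2 ≤ L := by linarith
  have hr3 : 169 * r ^ 3 ≤ L := by
    rw [hL, pow_succ' r 3]
    gcongr
  have hr32 : 169 * r ≤ 169 * r ^ 3 := by
    gcongr
    exact le_self_pow₀ hr1 (by norm_num)
  have hPP : ((P + P).card : ℝ) ≤ L * P.card := by
    have h := hPPs.card_le_coverNum (half_pos hδ) hδ (u := 2 * δ) (by positivity) hXXn (by
      intro z hz
      obtain ⟨p, hp, q, hq, rfl⟩ := Finset.mem_add.1 hz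
      obtain ⟨x, hx, hpx⟩ := hPX p hp
      obtain ⟨y, hy, hqy⟩ := hPX q hq
      refine ⟨x + y, Set.add_mem_add hx hy, ?_⟩
      rw [add_sub_add_comm]
      refine (norm_add_le _ _).trans ?_
      linarith)
    rw [show 1 + 2 * (2 * δ + δ) / (δ / 2) = 13 by field_simp; norm_num] at h
    calc ((P + P).card : ℝ) ≤ coverNum δ (X + X) * 13 ^ 2 := h
      _ ≤ r * N * 13 ^ 2 := by gcongr
      _ = 169 * r * N := by ring
      _ ≤ L * P.card := by
          gcongr
          exact hr32.trans hr3
  have hPa : ∀ a ∈ A, ∀ Q : Finset ℂ, (∀ z ∈ Q, ∃ x ∈ P, ∃ y ∈ P, z = x + a * y) →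
      Separated (δ / 2) Q → (Q.card : ℝ) ≤ L * P.card := by
    intro a ha Q hQ hQs
    have h := hQs.card_le_coverNum (half_pos hδ) hδ (u := δ + r * δ) (by positivity)
      (hXaXn a ha) (by
      intro z hz
      obtain ⟨p, hp, q, hq, rfl⟩ := hQ z hz
      obtain ⟨x, hx, hpx⟩ := hPX p hp
      obtain ⟨y, hy, hqy⟩ := hPX q hq
      refine ⟨x + a • y, Set.add_mem_add hx (Set.smul_mem_smul_set hy), ?_⟩
      rw [smul_eq_mul, add_sub_add_comm, ← mul_sub]
      refine (norm_add_le _ _).trans (add_le_add hpx ?_)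
      rw [norm_mul]
      exact mul_le_mul (hAn a ha) hqy (norm_nonneg _) hr0.le)
    rw [show 1 + 2 * (δ + r * δ + δ) / (δ / 2) = 9 + 4 * r by field_simp; ring] at h
    calc (Q.card : ℝ) ≤ coverNum δ (X + a • X) * (9 + 4 * r) ^ 2 := h
      _ ≤ r * N * (13 * r) ^ 2 := by
          gcongr
          · exact hXaX a ha
          · linarith
      _ = 169 * r ^ 3 * N := by ring
      _ ≤ L * P.card := by gcongr
  have hample : Ample κ ε₁ δ A := by
    have h : Ample κ ε δ A := ⟨hAn, hA, hAim⟩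
    exact h.change hδ le_rfl
      (Real.rpow_le_rpow_of_exponent_ge hδ hδ1.le (min_le_left _ _))
  obtain ⟨B, hBA, hBs, hBc⟩ := hgenδ A hample
  set ρ := δ ^ (σ / 8) with hρ
  have hρ0 : 0 < ρ := hpos _
  have hρ1 : ρ ≤ 1 := Real.rpow_le_one hδ.le hδ1.le (by positivity)
  have hδρ : δ ≤ ρ := by
    have := Real.rpow_le_rpow_of_exponent_ge hδ hδ1.le (show σ / 8 ≤ 1 by linarith)
    rwa [Real.rpow_one] at this
  obtain ⟨Y, hYP, hYs, hYmax⟩ := exists_maximal_separated hρ0 (S := (P : Set ℂ)) (r := r + δ) (by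
    intro p hp
    obtain ⟨x, hx, hpx⟩ := hPX p hp
    calc ‖p‖ = ‖x + (p - x)‖ := by rw [add_sub_cancel]
      _ ≤ r + δ := (norm_add_le _ _).trans (add_le_add (hXn x hx) hpx))
  have hLD : L ^ D = δ ^ (-(4 * D * ε)) := by
    rw [← hr4, ← Real.rpow_natCast, ← Real.rpow_mul hδ.le]
    congr 1
    ring
  refine false_of_dilates_small hδ hρ0 (T := L ^ D) (by positivity) hPne hPs
    (by exact_mod_cast hYP) hYs hBs
    (fun b hb => hD δ P A L hδ hPne hL2 (fun a ha => (hAn a ha).trans hrL) hPs hPP hPa b (hBA hb))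
    ?_ ?_
  · have h1 : coverNum (2 * ρ) X ≤ Y.card := coverNum_le_card Y (by
      intro x hx
      obtain ⟨p, hp, hxp⟩ := hXP x hx
      obtain ⟨y, hy, hpy⟩ := hYmax p hp
      refine ⟨y, hy, ?_⟩
      calc ‖x - y‖ = ‖(x - p) + (p - y)‖ := by rw [sub_add_sub_cancel]
        _ ≤ δ + ρ := (norm_add_le _ _).trans (add_le_add hxp hpy.le)
        _ ≤ 2 * ρ := by linarith)
    have h1' : (coverNum (2 * ρ) X : ℝ) ≤ Y.card := Nat.cast_le.2 h1
    refine lt_of_lt_of_le ?_ ((hX (2 * ρ) (by linarith)).trans h1')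
    have e1 : (2 * ρ) ^ (-κ) = (2 ^ κ)⁻¹ * δ ^ (-(σ * κ / 8)) := by
      rw [Real.mul_rpow (by norm_num) hρ0.le, Real.rpow_neg (by norm_num), hρ,
        ← Real.rpow_mul hδ.le]
      congr 2
      ring
    have h2κ : (0 : ℝ) < 2 ^ κ := by positivity
    rw [e1, hLD]
    have e2 : δ ^ (σ * κ / 16) * (δ ^ ε * δ ^ (-(σ * κ / 8))) ≥ δ ^ (-(4 * D * ε)) := by
      rw [← Real.rpow_add hδ, ← Real.rpow_add hδ]
      exact Real.rpow_le_rpow_of_exponent_ge hδ hδ1.le (by linarith)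
    have hq : 0 < δ ^ ε * δ ^ (-(σ * κ / 8)) := mul_pos (hpos _) (hpos _)
    have e3 : δ ^ ε * ((2 ^ κ)⁻¹ * δ ^ (-(σ * κ / 8))) =
        (δ ^ ε * δ ^ (-(σ * κ / 8))) / 2 ^ κ := by
      rw [div_eq_mul_inv]
      ring
    rw [e3, lt_div_iff₀ h2κ]
    calc 2 * δ ^ (-(4 * D * ε)) * 2 ^ κ
        ≤ 2 * (δ ^ (σ * κ / 16) * (δ ^ ε * δ ^ (-(σ * κ / 8)))) * 2 ^ κ := by gcongr
      _ = (2 * 2 ^ κ * δ ^ (σ * κ / 16)) * (δ ^ ε * δ ^ (-(σ * κ / 8))) := by ring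
      _ < _ := mul_lt_of_lt_one_left hq hYδ
  · refine le_trans ?_ hBc
    have h1 : 1 + 2 / ρ ≤ 3 / ρ := by
      rw [le_div_iff₀ hρ0, add_mul, div_mul_cancel₀ _ hρ0.ne']
      linarith
    have h3 : (3 / ρ) ^ 2 = 9 * δ ^ (-(σ / 4)) := by
      rw [div_pow, hρ, ← Real.rpow_natCast (δ ^ (σ / 8)), ← Real.rpow_mul hδ.le,
        Real.rpow_neg hδ.le, div_eq_mul_inv]
      congr 1
      · norm_num
      · congr 2
        push_cast
        ring
    have h4 : (P.card : ℝ) ≤ 81 * δ ^ (-(2 - σ) - ε) := hP81.trans (by gcongr)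
    have h5 : δ ^ (-(4 * D * ε)) * (δ ^ (-(σ / 4)) * δ ^ (-(2 - σ) - ε)) ≤
        δ ^ (σ / 4) * δ ^ (σ / 4 - 2) := by
      rw [← Real.rpow_add hδ, ← Real.rpow_add hδ, ← Real.rpow_add hδ]
      exact Real.rpow_le_rpow_of_exponent_ge hδ hδ1.le (by linarith)
    calc 2 * L ^ D * ((1 + 2 / ρ) ^ 2 * P.card)
        ≤ 2 * L ^ D * ((3 / ρ) ^ 2 * (81 * δ ^ (-(2 - σ) - ε))) := by gcongr
      _ = 1458 * (δ ^ (-(4 * D * ε)) * (δ ^ (-(σ / 4)) * δ ^ (-(2 - σ) - ε))) := by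
          rw [h3, hLD]
          ring
      _ ≤ 1458 * (δ ^ (σ / 4) * δ ^ (σ / 4 - 2)) := by gcongr
      _ = 1458 * δ ^ (σ / 4) * δ ^ (σ / 4 - 2) := by ring
      _ ≤ δ ^ (σ / 4 - 2) := mul_le_of_le_one_left (hpos _).le hBδ.le

end
end
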